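/- arXiv:1009.4549 — 2 statements merged into one kernel-verified Lean document; each statement's English description precedes it below -/
import Mathlib

section
/- Let (μ,ν) ∈ Ξ. Then for every j ∈ ℕ₀ the squared L²-norm of Λ_{2,j}^{μ,ν} is given by ∫_0^∞ |Λ_{2,j}^{μ,ν}(x)|²·x^{μ+ν+1} dx = 2^{μ+ν−1}·Γ(j+(μ+ν+2)/2)·Γ(j+(μ−ν+2)/2)/(j!·(2j+μ+1)·Γ(j+μ+1)). -/
noncomputable section

open Set MeasureTheory Filter Topology

/-- The Euler operator `θ = x·d/dx` acting on real-valued functions on `ℝ`. -/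
def eulerOp (u : ℝ → ℝ) : ℝ → ℝ := fun x => x * deriv u x

/-- The operator `(θ + a)(θ + b) − x²` applied to `v`. -/
def quadOp (a b : ℝ) (v : ℝ → ℝ) : ℝ → ℝ := fun x =>
  eulerOp (fun y => eulerOp v y + b * v y) x
    + a * (eulerOp v x + b * v x) - x ^ 2 * v x

/-- The fourth-order operator `D_{μ,ν} = x⁻²((θ+μ+ν)(θ+μ) − x²)(θ(θ+ν) − x²)`. -/
def Dop (μ ν : ℝ) (u : ℝ → ℝ) : ℝ → ℝ := fun x =>
  quadOp (μ + ν) μ (quadOp 0 ν u) x / x ^ 2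

/-- The normalized I-Bessel function `Ĩ_α(z) = Σ (z/2)^{2n}/(n!·Γ(n+α+1))`. -/
def tildeI (α z : ℝ) : ℝ :=
  ∑' n : ℕ, (z / 2) ^ (2 * n) / ((n.factorial : ℝ) * Real.Gamma ((n : ℝ) + α + 1))

/-- The K-Bessel function `K_α(z) = ∫₀^∞ e^{−z·cosh s}·cosh(α·s) ds`. -/
def besselK (α z : ℝ) : ℝ :=
  ∫ s in Ioi (0 : ℝ), Real.exp (-z * Real.cosh s) * Real.cosh (α * s)

/-- The normalized K-Bessel function `K̃_α(z) = (z/2)^{−α}·K_α(z)`. -/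
def tildeK (α z : ℝ) : ℝ := (z / 2) ^ (-α) * besselK α z

/-- The generating function `G₁^{μ,ν}(t,x)`. -/
def genG₁ (μ ν t x : ℝ) : ℝ :=
  (1 - t) ^ (-(μ + ν + 2) / 2) * tildeI (μ / 2) (t * x / (1 - t)) * tildeI (ν / 2) (x / (1 - t))

/-- The generating function `G₂^{μ,ν}(t,x)`. -/
def genG₂ (μ ν t x : ℝ) : ℝ :=
  (1 - t) ^ (-(μ + ν + 2) / 2) * tildeI (μ / 2) (t * x / (1 - t)) * tildeK (ν / 2) (x / (1 - t))

/-- The generating function `G₃^{μ,ν}(t,x)`. -/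
def genG₃ (μ ν t x : ℝ) : ℝ :=
  (1 - t) ^ (-(μ + ν + 2) / 2) * tildeK (μ / 2) (t * x / (1 - t)) * tildeI (ν / 2) (x / (1 - t))

/-- The generating function `G₄^{μ,ν}(t,x)`. -/
def genG₄ (μ ν t x : ℝ) : ℝ :=
  (1 - t) ^ (-(μ + ν + 2) / 2) * tildeK (μ / 2) (t * x / (1 - t)) * tildeK (ν / 2) (x / (1 - t))

/-- `Λ₁ⱼ^{μ,ν}(x) = (1/j!)·(∂/∂t)^j|₀ G₁^{μ,ν}(t,x)`. -/
def Lambda₁ (μ ν : ℝ) (j : ℕ) (x : ℝ) : ℝ :=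
  iteratedDeriv j (fun t => genG₁ μ ν t x) 0 / (j.factorial : ℝ)

/-- `Λ₂ⱼ^{μ,ν}(x) = (1/j!)·(∂/∂t)^j|₀ G₂^{μ,ν}(t,x)`. -/
def Lambda₂ (μ ν : ℝ) (j : ℕ) (x : ℝ) : ℝ :=
  iteratedDeriv j (fun t => genG₂ μ ν t x) 0 / (j.factorial : ℝ)

/-- `Λ₁ⱼ` for integer `j`, vanishing for `j < 0`. -/
def Lambda₁Z (μ ν : ℝ) (j : ℤ) (x : ℝ) : ℝ :=
  if 0 ≤ j then Lambda₁ μ ν j.toNat x else 0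

/-- `Λ₂ⱼ` for integer `j`, vanishing for `j < 0`. -/
def Lambda₂Z (μ ν : ℝ) (j : ℤ) (x : ℝ) : ℝ :=
  if 0 ≤ j then Lambda₂ μ ν j.toNat x else 0

/-- For `μ = m` a positive odd integer, `Λ₃ⱼ^{μ,ν}(x) = (1/(j+μ)!)·(∂/∂t)^{j+μ}|₀ [tᵐ·G₃]`,
the derivative at `0` being the limit from the right of the `(j+μ)`-th derivative of the
real-analytic function `t ↦ tᵐ·G₃^{m,ν}(t,x)` on `(0,1)`; it vanishes for `j < −μ`. -/
def Lambda₃ (m : ℕ) (ν : ℝ) (j : ℤ) (x : ℝ) : ℝ :=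
  if -(m : ℤ) ≤ j then
    limUnder (𝓝[>] (0 : ℝ))
        (fun t => iteratedDeriv (j + (m : ℤ)).toNat (fun s => s ^ m * genG₃ (m : ℝ) ν s x) t) /
      (((j + (m : ℤ)).toNat.factorial : ℝ))
  else 0

/-- For `μ = m` a positive odd integer, `Λ₄ⱼ^{μ,ν}(x) = (1/(j+μ)!)·(∂/∂t)^{j+μ}|₀ [tᵐ·G₄]`,
vanishing for `j < −μ`. -/
def Lambda₄ (m : ℕ) (ν : ℝ) (j : ℤ) (x : ℝ) : ℝ :=
  if -(m : ℤ) ≤ j then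
    limUnder (𝓝[>] (0 : ℝ))
        (fun t => iteratedDeriv (j + (m : ℤ)).toNat (fun s => s ^ m * genG₄ (m : ℝ) ν s x) t) /
      (((j + (m : ℤ)).toNat.factorial : ℝ))
  else 0

/-- The parameter set `Ξ = {(μ,−1) : 2μ ∈ ℕ₀} ∪ {(μ,0) : μ ∈ ℕ₀} ∪
{(μ,ν) : μ,ν ∈ ℕ₀, μ+ν even}`. -/
def XiCond (μ ν : ℝ) : Prop :=
  (ν = -1 ∧ ∃ k : ℕ, 2 * μ = (k : ℝ)) ∨ (ν = 0 ∧ ∃ k : ℕ, μ = (k : ℝ)) ∨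
  (∃ a b : ℕ, μ = (a : ℝ) ∧ ν = (b : ℝ) ∧ Even (a + b))

/-- The function `q ↦ ∫₀^∞ w^(c-1) exp(-w - q/w) dw`, which is `2 * tildeK (-c) (2 * √q)`. -/
def macdonald (c q : ℝ) : ℝ :=
  ∫ w in Ioi (0 : ℝ), w ^ (c - 1) * Real.exp (-w - q / w)

lemma exp_neg_div_le {q w : ℝ} (hq : 0 < q) (hw : 0 < w) (n : ℕ) :
    Real.exp (-(q / w)) ≤ n.factorial / q ^ n * w ^ n := by
  have h := Real.pow_div_factorial_le_exp (q / w) (by positivity) n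
  rw [Real.exp_neg, inv_le_comm₀ (by positivity) (by positivity)]
  refine le_trans (le_of_eq ?_) h
  rw [div_pow]
  field_simp

lemma exists_rpow_mul_exp_neg_le {q : ℝ} (hq : 0 < q) (c : ℝ) :
    ∃ C m : ℝ, 0 < m ∧ ∀ w : ℝ, 0 < w →
      w ^ c * Real.exp (-w - q / w) ≤ C * (w ^ m * Real.exp (-w)) := by
  obtain ⟨n, hn⟩ := exists_nat_gt (-c)
  refine ⟨n.factorial / q ^ n, c + n, by linarith, fun w hw => ?_⟩
  rw [sub_eq_add_neg, Real.exp_add, Real.rpow_add hw, Real.rpow_natCast]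
  have := exp_neg_div_le hq hw n
  calc w ^ c * (Real.exp (-w) * Real.exp (-(q / w)))
      ≤ w ^ c * (Real.exp (-w) * (n.factorial / q ^ n * w ^ n)) := by gcongr
    _ = _ := by ring

lemma continuousOn_rpow_mul_exp_neg (c q : ℝ) :
    ContinuousOn (fun w : ℝ => w ^ c * Real.exp (-w - q / w)) (Ioi 0) := by
  intro w hw
  have hw : w ≠ 0 := ne_of_gt hw
  refine ContinuousAt.continuousWithinAt ?_
  fun_prop (disch := simp [hw])

lemma integrableOn_rpow_mul_exp_neg {q : ℝ} (hq : 0 < q) (c : ℝ) :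
    IntegrableOn (fun w : ℝ => w ^ c * Real.exp (-w - q / w)) (Ioi 0) := by
  obtain ⟨C, m, hm, hC⟩ := exists_rpow_mul_exp_neg_le hq c
  have h := (Real.GammaIntegral_convergent (s := m + 1) (by linarith)).const_mul C
  refine Integrable.mono' h
    ((continuousOn_rpow_mul_exp_neg c q).aestronglyMeasurable measurableSet_Ioi) ?_
  filter_upwards [self_mem_ae_restrict measurableSet_Ioi] with w hw
  have hw : 0 < w := hw
  rw [Real.norm_of_nonneg (by positivity)]
  refine (hC w hw).trans (le_of_eq ?_)
  rw [add_sub_cancel_right]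
  ring

lemma macdonald_pos {q : ℝ} (hq : 0 < q) (c : ℝ) : 0 < macdonald c q := by
  unfold macdonald
  refine (setIntegral_pos_iff_support_of_nonneg_ae ?_ (integrableOn_rpow_mul_exp_neg hq _)).2 ?_
  · filter_upwards [self_mem_ae_restrict measurableSet_Ioi] with w hw
    have hw : 0 < w := hw
    positivity
  · refine lt_of_lt_of_le ?_ (measure_mono (s := Ioi (0 : ℝ)) fun w hw => ⟨?_, hw⟩)
    · simp
    · have hw : 0 < w := hw
      exact (by positivity : 0 < w ^ (c - 1) * Real.exp (-w - q / w)).ne'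

lemma hasDerivAt_macdonald {q : ℝ} (hq : 0 < q) (c : ℝ) :
    HasDerivAt (macdonald c) (-macdonald (c - 1) q) q := by
  have key := hasDerivAt_integral_of_dominated_loc_of_deriv_le
    (μ := volume.restrict (Ioi (0 : ℝ))) (x₀ := q) (s := Ioi (q / 2))
    (F := fun q w => w ^ (c - 1) * Real.exp (-w - q / w))
    (F' := fun q w => -(w ^ (c - 1 - 1) * Real.exp (-w - q / w)))
    (bound := fun w => w ^ (c - 1 - 1) * Real.exp (-w - (q / 2) / w))
    (Ioi_mem_nhds (by linarith))
    (Eventually.of_forall fun q =>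
      (continuousOn_rpow_mul_exp_neg _ q).aestronglyMeasurable measurableSet_Ioi)
    (integrableOn_rpow_mul_exp_neg hq _)
    ((continuousOn_rpow_mul_exp_neg _ q).aestronglyMeasurable measurableSet_Ioi).neg
    ?_ (integrableOn_rpow_mul_exp_neg (by linarith) _) ?_
  · have h := key.2
    rw [integral_neg] at h
    exact h
  · filter_upwards [self_mem_ae_restrict measurableSet_Ioi] with w hw x hx
    have hw : 0 < w := hw
    have hx : q / 2 < x := hx
    rw [norm_neg, Real.norm_of_nonneg (by positivity)]
    gcongr
  · filter_upwards [self_mem_ae_restrict measurableSet_Ioi] with w hw x _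
    have hw : 0 < w := hw
    have h : HasDerivAt (fun x : ℝ => -w - x / w) (-(1 / w)) x := by
      simpa using ((hasDerivAt_id x).div_const w).const_sub (-w)
    refine (h.exp.const_mul (w ^ (c - 1))).congr_deriv ?_
    rw [Real.rpow_sub_one hw.ne' (c - 1)]
    ring

/-- The three-term recurrence of the Macdonald function. -/
lemma macdonald_add_one {q : ℝ} (hq : 0 < q) (c : ℝ) :
    macdonald (c + 1) q = c * macdonald c q + q * macdonald (c - 1) q := by
  have i1 := integrableOn_rpow_mul_exp_neg hq (c + 1 - 1)
  have i2 := (integrableOn_rpow_mul_exp_neg hq (c - 1)).const_mul c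
  have i3 := (integrableOn_rpow_mul_exp_neg hq (c - 1 - 1)).const_mul q
  have i23 : IntegrableOn (fun w : ℝ => c * (w ^ (c - 1) * Real.exp (-w - q / w))
      + q * (w ^ (c - 1 - 1) * Real.exp (-w - q / w))) (Ioi 0) := i2.add i3
  obtain ⟨C, m, hm, hC⟩ := exists_rpow_mul_exp_neg_le hq c
  have hpt : ∀ w ∈ Ioi (0 : ℝ), c * w ^ (c - 1) * Real.exp (-w - q / w)
      + w ^ c * (Real.exp (-w - q / w) * (-1 + q / w ^ 2))
      = c * (w ^ (c - 1) * Real.exp (-w - q / w)) + q * (w ^ (c - 1 - 1) * Real.exp (-w - q / w))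
        - w ^ (c + 1 - 1) * Real.exp (-w - q / w) := by
    intro w hw
    have hw : 0 < w := hw
    rw [Real.rpow_sub_one hw.ne' (c - 1), Real.rpow_sub_one hw.ne' c, add_sub_cancel_right]
    field_simp
    ring
  have hint : IntegrableOn (fun w : ℝ => c * (w ^ (c - 1) * Real.exp (-w - q / w))
      + q * (w ^ (c - 1 - 1) * Real.exp (-w - q / w))
        - w ^ (c + 1 - 1) * Real.exp (-w - q / w)) (Ioi 0) := i23.sub i1
  have hb : Tendsto (fun w : ℝ => C * (w ^ m * Real.exp (-w))) (𝓝[>] 0) (𝓝 0) := by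
    have : ContinuousAt (fun w : ℝ => C * (w ^ m * Real.exp (-w))) 0 := by
      fun_prop (disch := simp [hm.le])
    have h := this.tendsto.mono_left (nhdsWithin_le_nhds (s := Ioi 0))
    simpa [Real.zero_rpow hm.ne'] using h
  have ht : Tendsto (fun w : ℝ => C * (w ^ m * Real.exp (-w))) atTop (𝓝 0) := by
    simpa using (tendsto_rpow_mul_exp_neg_mul_atTop_nhds_zero m 1 one_pos).const_mul C
  have h := integral_Ioi_deriv_mul_eq_sub (a := (0 : ℝ)) (a' := (0 : ℝ)) (b' := (0 : ℝ))
    (u := fun w : ℝ => w ^ c) (u' := fun w => c * w ^ (c - 1))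
    (v := fun w => Real.exp (-w - q / w))
    (v' := fun w => Real.exp (-w - q / w) * (-1 + q / w ^ 2))
    (fun w hw => by
      simpa using Real.hasDerivAt_rpow_const (p := c) (Or.inl (ne_of_gt hw)))
    (fun w hw => by
      have hw : w ≠ 0 := ne_of_gt hw
      refine HasDerivAt.exp ?_
      refine ((hasDerivAt_neg w).sub ((hasDerivAt_const w q).div (hasDerivAt_id w) hw)).congr_deriv
        ?_
      simp
      ring)
    (hint.congr_fun (fun w hw => (hpt w hw).symm) measurableSet_Ioi)
    (squeeze_zero' (by
        filter_upwards [self_mem_nhdsWithin] with w hw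
        have hw : 0 < w := hw
        exact mul_nonneg (by positivity) (by positivity)) (by
        filter_upwards [self_mem_nhdsWithin] with w hw using hC w hw) hb)
    (squeeze_zero' (by
        filter_upwards [eventually_gt_atTop 0] with w hw
        exact mul_nonneg (by positivity) (by positivity)) (by
        filter_upwards [eventually_gt_atTop 0] with w hw using hC w hw) ht)
  rw [setIntegral_congr_fun measurableSet_Ioi hpt, integral_sub i23 i1,
    integral_add i2 i3, integral_const_mul, integral_const_mul] at h
  unfold macdonald
  linarith

lemma tildeK_eq_macdonald (α : ℝ) {z : ℝ} (hz : 0 < z) :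
    tildeK α z = macdonald (-α) (z ^ 2 / 4) / 2 := by
  have himg : (fun s : ℝ => z / 2 * Real.exp s) '' univ = Ioi 0 := by
    ext w
    simp only [image_univ, mem_range, mem_Ioi]
    constructor
    · rintro ⟨s, rfl⟩
      positivity
    · intro hw
      refine ⟨Real.log (2 * w / z), ?_⟩
      rw [Real.exp_log (by positivity)]
      field_simp
  have hd : ∀ s ∈ (univ : Set ℝ), HasDerivWithinAt (fun s : ℝ => z / 2 * Real.exp s)
      (z / 2 * Real.exp s) univ s := fun s _ =>
    ((Real.hasDerivAt_exp s).const_mul (z / 2)).hasDerivWithinAt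
  have hinj : InjOn (fun s : ℝ => z / 2 * Real.exp s) univ := fun a _ b _ hab =>
    Real.exp_injective (mul_left_cancel₀ (by positivity) hab)
  have hq : 0 < z ^ 2 / 4 := by positivity
  have hpt : ∀ s : ℝ, |z / 2 * Real.exp s| • ((z / 2 * Real.exp s) ^ (-α - 1) *
      Real.exp (-(z / 2 * Real.exp s) - z ^ 2 / 4 / (z / 2 * Real.exp s)))
      = (z / 2) ^ (-α) * (Real.exp (-z * Real.cosh s) * Real.exp (-α * s)) := by
    intro s
    have e1 : -(z / 2 * Real.exp s) - z ^ 2 / 4 / (z / 2 * Real.exp s) = -z * Real.cosh s := by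
      rw [Real.cosh_eq, Real.exp_neg]
      field_simp
      ring
    rw [e1, abs_of_pos (by positivity), smul_eq_mul, Real.rpow_sub_one (by positivity),
      Real.mul_rpow (by positivity) (by positivity), ← Real.exp_mul, mul_comm s]
    field_simp
  have hint : Integrable (fun s : ℝ => Real.exp (-z * Real.cosh s) * Real.exp (-α * s)) := by
    have h := (integrableOn_image_iff_integrableOn_abs_deriv_smul MeasurableSet.univ hd hinj
      (fun w => w ^ (-α - 1) * Real.exp (-w - z ^ 2 / 4 / w))).1
      (himg ▸ integrableOn_rpow_mul_exp_neg hq _)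
    simp only [hpt, integrableOn_univ] at h
    have h2 := h.const_mul (((z / 2) ^ (-α))⁻¹)
    refine h2.congr (Eventually.of_forall fun s => ?_)
    have : (z / 2) ^ (-α) ≠ 0 := by positivity
    simp only []
    field_simp
  have hM : macdonald (-α) (z ^ 2 / 4)
      = (z / 2) ^ (-α) * ∫ s : ℝ, Real.exp (-z * Real.cosh s) * Real.exp (-α * s) := by
    unfold macdonald
    rw [← himg, integral_image_eq_integral_abs_deriv_smul MeasurableSet.univ hd hinj]
    simp only [hpt, setIntegral_univ]
    rw [integral_const_mul]
  have hK : 2 * besselK α z = ∫ s : ℝ, Real.exp (-z * Real.cosh s) * Real.exp (-α * s) := by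
    have h := integral_comp_abs (f := fun s => Real.exp (-z * Real.cosh s) * Real.cosh (α * s))
    have hc : ∀ s : ℝ, Real.cosh (α * |s|) = Real.cosh (α * s) := fun s => by
      rcases abs_cases s with ⟨h, _⟩ | ⟨h, _⟩ <;> simp [h]
    simp only [Real.cosh_abs, hc] at h
    unfold besselK
    rw [← h]
    have hneg := integral_neg_eq_self
      (fun s : ℝ => Real.exp (-z * Real.cosh s) * Real.exp (-α * s)) volume
    have hint' := hint.comp_neg
    have hs : ∀ s : ℝ, Real.exp (-z * Real.cosh s) * Real.cosh (α * s)
        = (Real.exp (-z * Real.cosh s) * Real.exp (-α * s)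
          + Real.exp (-z * Real.cosh (-s)) * Real.exp (-α * (-s))) / 2 := fun s => by
      rw [Real.cosh_eq (α * s), Real.cosh_neg]
      ring_nf
    simp only [hs]
    rw [integral_div, integral_add hint hint', hneg]
    ring
  rw [hM, ← hK]
  unfold tildeK
  ring

lemma lintegral_ofReal_of_integral_eq {f : ℝ → ℝ} {s : Set ℝ} {v : ℝ} (hs : MeasurableSet s)
    (hf : ∀ x ∈ s, 0 ≤ f x) (hv : v ≠ 0) (h : ∫ x in s, f x = v) :
    ∫⁻ x in s, ENNReal.ofReal (f x) = ENNReal.ofReal v := by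
  have hi : IntegrableOn f s := by
    by_contra hn
    exact hv (h ▸ integral_undef hn)
  rw [← h, ofReal_integral_eq_lintegral_ofReal hi]
  filter_upwards [self_mem_ae_restrict hs] with x hx using hf x hx

lemma lintegral_rpow_mul_exp_neg_mul {a r : ℝ} (ha : 0 < a) (hr : 0 < r) :
    ∫⁻ y in Ioi (0 : ℝ), ENNReal.ofReal (y ^ (a - 1) * Real.exp (-(r * y)))
      = ENNReal.ofReal (r ^ (-a) * Real.Gamma a) := by
  have hΓ := Real.Gamma_pos_of_pos ha
  refine lintegral_ofReal_of_integral_eq measurableSet_Ioi (fun x hx => ?_) (by positivity) ?_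
  · have hx : 0 < x := hx
    positivity
  · rw [Real.integral_rpow_mul_exp_neg_mul_Ioi ha hr, one_div, Real.inv_rpow hr.le,
      Real.rpow_neg hr.le]

lemma lintegral_rpow_mul_exp_neg_mul_sq {p r : ℝ} (hp : 0 < p) (hr : 0 < r) :
    ∫⁻ x in Ioi (0 : ℝ), ENNReal.ofReal (x ^ (2 * p - 1) * Real.exp (-(r * x ^ 2)))
      = ENNReal.ofReal (r ^ (-p) * Real.Gamma p / 2) := by
  have hΓ := Real.Gamma_pos_of_pos hp
  refine lintegral_ofReal_of_integral_eq measurableSet_Ioi (fun x hx => ?_) (by positivity) ?_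
  · have hx : 0 < x := hx
    positivity
  · have h := integral_rpow_mul_exp_neg_mul_rpow (p := 2) (q := 2 * p - 1) (b := r) two_pos
      (by linarith) hr
    simp only [neg_mul, Real.rpow_two] at h
    rw [h]
    ring_nf

lemma lintegral_rpow_mul_one_add_rpow {p t : ℝ} (hp : 0 < p) (ht : 0 < t) :
    ∫⁻ r in Ioi (0 : ℝ), ENNReal.ofReal (r ^ (p - 1) * (1 + r) ^ (-(p + t)))
      = ENNReal.ofReal (Real.Gamma p * Real.Gamma t / Real.Gamma (p + t)) := by
  have hΓp := Real.Gamma_pos_of_pos hp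
  have hΓt := Real.Gamma_pos_of_pos ht
  have hΓ := Real.Gamma_pos_of_pos (add_pos hp ht)
  have h1 : ∫⁻ r in Ioi (0 : ℝ), ENNReal.ofReal (r ^ (p - 1) * (1 + r) ^ (-(p + t)))
      = ∫⁻ r in Ioi (0 : ℝ), ∫⁻ y in Ioi (0 : ℝ), ENNReal.ofReal
        ((Real.Gamma (p + t))⁻¹ * r ^ (p - 1) * (y ^ (p + t - 1) * Real.exp (-((1 + r) * y)))) := by
    refine setLIntegral_congr_fun measurableSet_Ioi fun r hr => ?_
    have hr : 0 < r := hr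
    simp only [ENNReal.ofReal_mul (show 0 ≤ (Real.Gamma (p + t))⁻¹ * r ^ (p - 1) by positivity)]
    rw [lintegral_const_mul _ (by fun_prop),
      lintegral_rpow_mul_exp_neg_mul (add_pos hp ht) (by positivity),
      ← ENNReal.ofReal_mul (by positivity)]
    congr 1
    field_simp
  have h2 : ∀ y ∈ Ioi (0 : ℝ), ∫⁻ r in Ioi (0 : ℝ), ENNReal.ofReal
        ((Real.Gamma (p + t))⁻¹ * r ^ (p - 1) * (y ^ (p + t - 1) * Real.exp (-((1 + r) * y))))
      = ENNReal.ofReal (Real.Gamma p / Real.Gamma (p + t)) *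
        ENNReal.ofReal (y ^ (t - 1) * Real.exp (-(1 * y))) := by
    intro y hy
    have hy : 0 < y := hy
    have hpt : ∀ r : ℝ, (Real.Gamma (p + t))⁻¹ * r ^ (p - 1) *
        (y ^ (p + t - 1) * Real.exp (-((1 + r) * y)))
        = (Real.Gamma (p + t))⁻¹ * y ^ (p + t - 1) * Real.exp (-y) *
          (r ^ (p - 1) * Real.exp (-(y * r))) := fun r => by
      rw [show -((1 + r) * y) = -y + -(y * r) by ring, Real.exp_add]
      ring
    simp only [hpt, ENNReal.ofReal_mul
      (show 0 ≤ (Real.Gamma (p + t))⁻¹ * y ^ (p + t - 1) * Real.exp (-y) by positivity)]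
    rw [lintegral_const_mul _ (by fun_prop), lintegral_rpow_mul_exp_neg_mul hp hy,
      ← ENNReal.ofReal_mul (by positivity), ← ENNReal.ofReal_mul (by positivity)]
    congr 1
    rw [show t - 1 = (p + t - 1) + -p by ring, Real.rpow_add hy]
    ring_nf
  rw [h1, lintegral_lintegral_swap (by fun_prop), setLIntegral_congr_fun measurableSet_Ioi h2,
    lintegral_const_mul _ (by fun_prop), lintegral_rpow_mul_exp_neg_mul ht one_pos,
    ← ENNReal.ofReal_mul (by positivity)]
  congr 1
  simp
  ring

lemma lintegral_lintegral_lintegral_rotate {μ : Measure ℝ} [SFinite μ]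
    {F : ℝ → ℝ → ℝ → ENNReal} (hF : Measurable fun z : (ℝ × ℝ) × ℝ => F z.1.1 z.1.2 z.2) :
    ∫⁻ x, ∫⁻ u, ∫⁻ v, F x u v ∂μ ∂μ ∂μ = ∫⁻ u, ∫⁻ v, ∫⁻ x, F x u v ∂μ ∂μ ∂μ := by
  rw [lintegral_lintegral_swap]
  · refine lintegral_congr fun u => ?_
    rw [lintegral_lintegral_swap]
    exact (hF.comp (f := fun z : ℝ × ℝ => ((z.1, u), z.2)) (by fun_prop)).aemeasurable
  · exact (Measurable.lintegral_prod_right' hF).aemeasurable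

lemma ofReal_macdonald {q : ℝ} (hq : 0 < q) (c : ℝ) :
    ENNReal.ofReal (macdonald c q)
      = ∫⁻ w in Ioi (0 : ℝ), ENNReal.ofReal (w ^ (c - 1) * Real.exp (-w - q / w)) := by
  unfold macdonald
  rw [ofReal_integral_eq_lintegral_ofReal (integrableOn_rpow_mul_exp_neg hq _)]
  filter_upwards [self_mem_ae_restrict measurableSet_Ioi] with w hw
  have hw : 0 < w := hw
  positivity

lemma lintegral_macdonald_mul_macdonald {p a b : ℝ} (hp : 0 < p) (ha : 0 < p + a)
    (hb : 0 < p + b) (hab : 0 < p + a + b) :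
    ∫⁻ x in Ioi (0 : ℝ), ENNReal.ofReal
        (macdonald a (x ^ 2 / 4) * macdonald b (x ^ 2 / 4) * x ^ (2 * p - 1))
      = ENNReal.ofReal (2 ^ (2 * p - 1) * Real.Gamma p * Real.Gamma (p + a) * Real.Gamma (p + b) *
          Real.Gamma (p + a + b) / Real.Gamma (2 * p + a + b)) := by
  have hΓp := Real.Gamma_pos_of_pos hp
  have hΓa := Real.Gamma_pos_of_pos ha
  have hΓb := Real.Gamma_pos_of_pos hb
  have h1 : ∀ x ∈ Ioi (0 : ℝ), ENNReal.ofReal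
        (macdonald a (x ^ 2 / 4) * macdonald b (x ^ 2 / 4) * x ^ (2 * p - 1))
      = ∫⁻ u in Ioi (0 : ℝ), ∫⁻ v in Ioi (0 : ℝ),
        ENNReal.ofReal (u ^ (a - 1) * Real.exp (-u - x ^ 2 / 4 / u)) *
        (ENNReal.ofReal (v ^ (b - 1) * Real.exp (-v - x ^ 2 / 4 / v)) *
          ENNReal.ofReal (x ^ (2 * p - 1))) := by
    intro x hx
    have hx : 0 < x := hx
    have hq : 0 < x ^ 2 / 4 := by positivity
    have hA := macdonald_pos hq a
    have hB := macdonald_pos hq b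
    rw [mul_assoc, ENNReal.ofReal_mul hA.le, ENNReal.ofReal_mul hB.le, ofReal_macdonald hq,
      ofReal_macdonald hq, ← lintegral_mul_const _ (by fun_prop),
      ← lintegral_mul_const _ (by fun_prop)]
    refine lintegral_congr fun u => ?_
    rw [← lintegral_const_mul _ (by fun_prop)]
  have h2 : ∀ u ∈ Ioi (0 : ℝ), ∀ v ∈ Ioi (0 : ℝ), ∫⁻ x in Ioi (0 : ℝ),
        ENNReal.ofReal (u ^ (a - 1) * Real.exp (-u - x ^ 2 / 4 / u)) *
        (ENNReal.ofReal (v ^ (b - 1) * Real.exp (-v - x ^ 2 / 4 / v)) *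
          ENNReal.ofReal (x ^ (2 * p - 1)))
      = ∫⁻ r in Ioi (0 : ℝ), ENNReal.ofReal (2 ^ (2 * p - 1) * r ^ (p - 1)) *
        (ENNReal.ofReal (u ^ (p + a - 1) * Real.exp (-((1 + r) * u))) *
        ENNReal.ofReal (v ^ (p + b - 1) * Real.exp (-((1 + r) * v)))) := by
    intro u hu v hv
    have hu : 0 < u := hu
    have hv : 0 < v := hv
    have e1 : ∀ x ∈ Ioi (0 : ℝ), ENNReal.ofReal (u ^ (a - 1) * Real.exp (-u - x ^ 2 / 4 / u)) *
        (ENNReal.ofReal (v ^ (b - 1) * Real.exp (-v - x ^ 2 / 4 / v)) *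
          ENNReal.ofReal (x ^ (2 * p - 1)))
        = ENNReal.ofReal (u ^ (a - 1) * v ^ (b - 1) * Real.exp (-(u + v))) *
          ENNReal.ofReal (x ^ (2 * p - 1) * Real.exp (-((u + v) / (4 * u * v) * x ^ 2))) := by
      intro x hx
      have hx : 0 < x := hx
      rw [← ENNReal.ofReal_mul (by positivity), ← ENNReal.ofReal_mul (by positivity),
        ← ENNReal.ofReal_mul (by positivity)]
      congr 1
      have : Real.exp (-u - x ^ 2 / 4 / u) * Real.exp (-v - x ^ 2 / 4 / v)
          = Real.exp (-(u + v)) * Real.exp (-((u + v) / (4 * u * v) * x ^ 2)) := by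
        rw [← Real.exp_add, ← Real.exp_add]
        congr 1
        field_simp
        ring
      linear_combination (u ^ (a - 1) * v ^ (b - 1) * x ^ (2 * p - 1)) * this
    have e2 : ∀ r ∈ Ioi (0 : ℝ), ENNReal.ofReal (2 ^ (2 * p - 1) * r ^ (p - 1)) *
        (ENNReal.ofReal (u ^ (p + a - 1) * Real.exp (-((1 + r) * u))) *
        ENNReal.ofReal (v ^ (p + b - 1) * Real.exp (-((1 + r) * v))))
        = ENNReal.ofReal (2 ^ (2 * p - 1) * u ^ (p + a - 1) * v ^ (p + b - 1)
            * Real.exp (-(u + v))) *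
          ENNReal.ofReal (r ^ (p - 1) * Real.exp (-((u + v) * r))) := by
      intro r hr
      have hr : 0 < r := hr
      rw [← ENNReal.ofReal_mul (by positivity), ← ENNReal.ofReal_mul (by positivity),
        ← ENNReal.ofReal_mul (by positivity)]
      congr 1
      have : Real.exp (-((1 + r) * u)) * Real.exp (-((1 + r) * v))
          = Real.exp (-(u + v)) * Real.exp (-((u + v) * r)) := by
        rw [← Real.exp_add, ← Real.exp_add]
        ring_nf
      linear_combination
        (2 ^ (2 * p - 1) * r ^ (p - 1) * u ^ (p + a - 1) * v ^ (p + b - 1)) * this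
    rw [setLIntegral_congr_fun measurableSet_Ioi e1, setLIntegral_congr_fun measurableSet_Ioi e2,
      lintegral_const_mul _ (by fun_prop), lintegral_const_mul _ (by fun_prop),
      lintegral_rpow_mul_exp_neg_mul_sq hp (by positivity),
      lintegral_rpow_mul_exp_neg_mul hp (by positivity),
      ← ENNReal.ofReal_mul (by positivity), ← ENNReal.ofReal_mul (by positivity)]
    congr 1
    have e3 : ((u + v) / (4 * u * v)) ^ (-p) = (u + v) ^ (-p) * 2 ^ (2 * p) * u ^ p * v ^ p := by
      rw [Real.rpow_neg (by positivity), Real.div_rpow (by positivity) (by positivity),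
        Real.mul_rpow (by positivity) (by positivity),
        Real.mul_rpow (by positivity) (by positivity), Real.rpow_mul (by positivity),
        Real.rpow_neg (by positivity)]
      norm_num
      ring
    rw [e3, show p + a - 1 = p + (a - 1) by ring, show p + b - 1 = p + (b - 1) by ring,
      Real.rpow_add hu, Real.rpow_add hv, Real.rpow_sub_one two_ne_zero]
    ring
  have h3 : ∀ r ∈ Ioi (0 : ℝ), ∫⁻ u in Ioi (0 : ℝ), ∫⁻ v in Ioi (0 : ℝ),
        ENNReal.ofReal (2 ^ (2 * p - 1) * r ^ (p - 1)) *
        (ENNReal.ofReal (u ^ (p + a - 1) * Real.exp (-((1 + r) * u))) *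
        ENNReal.ofReal (v ^ (p + b - 1) * Real.exp (-((1 + r) * v))))
      = ENNReal.ofReal (2 ^ (2 * p - 1) * Real.Gamma (p + a) * Real.Gamma (p + b)) *
        ENNReal.ofReal (r ^ (p - 1) * (1 + r) ^ (-(p + (p + a + b)))) := by
    intro r hr
    have hr : 0 < r := hr
    have e1 : ∀ u : ℝ, ∫⁻ v in Ioi (0 : ℝ),
        ENNReal.ofReal (2 ^ (2 * p - 1) * r ^ (p - 1)) *
        (ENNReal.ofReal (u ^ (p + a - 1) * Real.exp (-((1 + r) * u))) *
        ENNReal.ofReal (v ^ (p + b - 1) * Real.exp (-((1 + r) * v))))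
        = ENNReal.ofReal (2 ^ (2 * p - 1) * r ^ (p - 1)) *
          (ENNReal.ofReal (u ^ (p + a - 1) * Real.exp (-((1 + r) * u))) *
          ENNReal.ofReal ((1 + r) ^ (-(p + b)) * Real.Gamma (p + b))) := by
      intro u
      rw [lintegral_const_mul _ (by fun_prop), lintegral_const_mul _ (by fun_prop),
        lintegral_rpow_mul_exp_neg_mul hb (by positivity)]
    simp only [e1]
    rw [lintegral_const_mul _ (by fun_prop), lintegral_mul_const _ (by fun_prop),
      lintegral_rpow_mul_exp_neg_mul ha (by positivity), ← ENNReal.ofReal_mul (by positivity),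
      ← ENNReal.ofReal_mul (by positivity), ← ENNReal.ofReal_mul (by positivity)]
    congr 1
    rw [show -(p + (p + a + b)) = -(p + a) + -(p + b) by ring, Real.rpow_add (by positivity)]
    ring
  rw [setLIntegral_congr_fun measurableSet_Ioi h1,
    lintegral_lintegral_lintegral_rotate (by fun_prop),
    setLIntegral_congr_fun measurableSet_Ioi fun u hu =>
      setLIntegral_congr_fun measurableSet_Ioi (h2 u hu),
    ← lintegral_lintegral_lintegral_rotate (by fun_prop),
    setLIntegral_congr_fun measurableSet_Ioi h3, lintegral_const_mul _ (by fun_prop),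
    lintegral_rpow_mul_one_add_rpow hp hab, ← ENNReal.ofReal_mul (by positivity)]
  congr 1
  ring_nf

lemma continuousOn_macdonald_sq (c : ℝ) :
    ContinuousOn (fun x : ℝ => macdonald c (x ^ 2 / 4)) (Ioi 0) := fun x hx => by
  have hx : 0 < x := hx
  exact ((hasDerivAt_macdonald (q := x ^ 2 / 4) (by positivity) c).continuousAt.comp
    (f := fun x : ℝ => x ^ 2 / 4) (by fun_prop)).continuousWithinAt

lemma integrableOn_and_integral_macdonald_mul_macdonald {p a b : ℝ} (hp : 0 < p)
    (ha : 0 < p + a) (hb : 0 < p + b) (hab : 0 < p + a + b) :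
    IntegrableOn (fun x : ℝ => macdonald a (x ^ 2 / 4) * macdonald b (x ^ 2 / 4)
      * x ^ (2 * p - 1)) (Ioi 0) ∧
    ∫ x in Ioi (0 : ℝ), macdonald a (x ^ 2 / 4) * macdonald b (x ^ 2 / 4) * x ^ (2 * p - 1)
      = 2 ^ (2 * p - 1) * Real.Gamma p * Real.Gamma (p + a) * Real.Gamma (p + b) *
          Real.Gamma (p + a + b) / Real.Gamma (2 * p + a + b) := by
  have hL := lintegral_macdonald_mul_macdonald hp ha hb hab
  have hnn : 0 ≤ᵐ[volume.restrict (Ioi (0 : ℝ))] fun x : ℝ =>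
      macdonald a (x ^ 2 / 4) * macdonald b (x ^ 2 / 4) * x ^ (2 * p - 1) := by
    filter_upwards [self_mem_ae_restrict measurableSet_Ioi] with x hx
    have hx : 0 < x := hx
    have hq : 0 < x ^ 2 / 4 := by positivity
    have hA := macdonald_pos hq a
    have hB := macdonald_pos hq b
    simp only [Pi.zero_apply]
    positivity
  have hm : AEStronglyMeasurable (fun x : ℝ => macdonald a (x ^ 2 / 4) * macdonald b (x ^ 2 / 4)
      * x ^ (2 * p - 1)) (volume.restrict (Ioi (0 : ℝ))) := by
    refine ContinuousOn.aestronglyMeasurable ?_ measurableSet_Ioi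
    refine ((continuousOn_macdonald_sq a).mul (continuousOn_macdonald_sq b)).mul ?_
    exact continuousOn_id.rpow_const fun x hx => Or.inl (ne_of_gt hx)
  refine ⟨⟨hm, ?_⟩, ?_⟩
  · rw [hasFiniteIntegral_iff_ofReal hnn, hL]
    exact ENNReal.ofReal_lt_top
  · have hΓp := Real.Gamma_pos_of_pos hp
    have hΓa := Real.Gamma_pos_of_pos ha
    have hΓb := Real.Gamma_pos_of_pos hb
    have hΓab := Real.Gamma_pos_of_pos hab
    have hΓ := Real.Gamma_pos_of_pos (show 0 < 2 * p + a + b by linarith)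
    rw [integral_eq_lintegral_of_nonneg_ae hnn hm, hL, ENNReal.toReal_ofReal (by positivity)]

open Polynomial in
/-- The linear functional on polynomials sending `X ^ k` to `macdonald (k - α) (y² / 4)`. -/
def macdonaldFunctional (α y : ℝ) : ℝ[X] →ₗ[ℝ] ℝ :=
  Polynomial.lsum fun k => macdonald (k - α) (y ^ 2 / 4) • LinearMap.id

open Polynomial in
/-- The operator `Q ↦ X * (Q - Q')` on polynomials, whose rising factorials send `1` to `X ^ k`. -/
def raising : Module.End ℝ ℝ[X] :=
  LinearMap.mulLeft ℝ X ∘ₗ (LinearMap.id - derivative)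

open Polynomial in
/-- The linear functional on polynomials sending the rising factorial `(X)_k` to
`macdonald (k - α) (y² / 4)`; it turns multiplication by `-2 * (X + α)` into `y * d/dy`. -/
def besselFunctional (α y : ℝ) : ℝ[X] →ₗ[ℝ] ℝ :=
  macdonaldFunctional α y ∘ₗ LinearMap.applyₗ 1 ∘ₗ (aeval raising).toLinearMap

open Polynomial in
lemma besselFunctional_apply (α y : ℝ) (P : ℝ[X]) :
    besselFunctional α y P = macdonaldFunctional α y (aeval raising P 1) := rfl

open Polynomial in
lemma macdonaldFunctional_monomial (α y : ℝ) (k : ℕ) (a : ℝ) :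
    macdonaldFunctional α y (monomial k a) = macdonald (k - α) (y ^ 2 / 4) * a := by
  simp [macdonaldFunctional, Polynomial.lsum_apply]

open Polynomial in
lemma raising_apply (Q : ℝ[X]) : raising Q = X * (Q - derivative Q) := rfl

open Polynomial in
lemma raising_monomial (k : ℕ) (a : ℝ) :
    raising (monomial k a) = monomial (k + 1) a - monomial k (k * a) := by
  rw [raising_apply, mul_sub, X_mul_monomial, derivative_monomial, X_mul_monomial]
  rcases k with _ | k
  · simp
  · simp [mul_comm]

open Polynomial in
lemma hasDerivAt_macdonaldFunctional (α : ℝ) (Q : ℝ[X]) {y : ℝ} (hy : 0 < y) :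
    HasDerivAt (fun y => macdonaldFunctional α y Q)
      (macdonaldFunctional α y (-(2 : ℝ) • raising Q - (2 * α) • Q) / y) y := by
  induction Q using Polynomial.induction_on' with
  | add P Q hP hQ =>
    simp only [map_add]
    refine (hP.add hQ).congr_deriv ?_
    simp only [map_sub, map_add, map_smul, smul_eq_mul]
    ring
  | monomial k a =>
    simp only [raising_monomial, map_sub, map_smul, macdonaldFunctional_monomial, smul_eq_mul]
    have hq : 0 < y ^ 2 / 4 := by positivity
    have h1 : HasDerivAt (fun y : ℝ => y ^ 2 / 4) (y / 2) y :=
      ((hasDerivAt_pow 2 y).div_const 4).congr_deriv (by push_cast; ring)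
    have h2 := ((hasDerivAt_macdonald hq (k - α)).comp y h1).mul_const a
    refine h2.congr_deriv ?_
    have h3 := macdonald_add_one hq (k - α)
    rw [show (k : ℝ) - α + 1 = (k + 1 : ℕ) - α by push_cast; ring] at h3
    rw [h3]
    field_simp
    ring

open Polynomial in
lemma mul_macdonaldFunctional (α : ℝ) (Q : ℝ[X]) {y : ℝ} (hy : 0 < y) :
    y ^ 2 / 4 * macdonaldFunctional α y Q
      = macdonaldFunctional α y (raising (X * Q) + α • (X * Q)) := by
  induction Q using Polynomial.induction_on' with
  | add P Q hP hQ => simp only [mul_add, map_add, hP, hQ, smul_add]; ring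
  | monomial k a =>
    have hq : 0 < y ^ 2 / 4 := by positivity
    have h3 := macdonald_add_one hq ((k + 1 : ℕ) - α)
    rw [show ((k + 1 : ℕ) : ℝ) - α + 1 = (k + 1 + 1 : ℕ) - α by push_cast; ring,
      show ((k + 1 : ℕ) : ℝ) - α - 1 = k - α by push_cast; ring] at h3
    simp only [X_mul_monomial, raising_monomial, map_sub, map_add, map_smul,
      macdonaldFunctional_monomial, smul_eq_mul, h3]
    push_cast
    ring

open Polynomial in
lemma aeval_raising_mul_X (P Q : ℝ[X]) :
    X * aeval raising P Q = aeval raising (P.comp (X + 1)) (X * Q) := by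
  induction P using Polynomial.induction_on generalizing Q with
  | C a => simp [Algebra.algebraMap_eq_smul_one]
  | add P R hP hR => simp [mul_add, hP, hR]
  | monomial n a h =>
    rw [pow_succ, ← mul_assoc, mul_comp, map_mul _ (C a * X ^ n), map_mul _ _ (X.comp _),
      Module.End.mul_apply, Module.End.mul_apply, h]
    congr 1
    simp only [aeval_X, X_comp, map_add, map_one, raising_apply, LinearMap.add_apply,
      Module.End.one_apply, derivative_mul, derivative_X]
    ring

open Polynomial in
lemma hasDerivAt_besselFunctional (α : ℝ) (P : ℝ[X]) {y : ℝ} (hy : 0 < y) :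
    HasDerivAt (fun y => besselFunctional α y P)
      (besselFunctional α y ((-C 2 * X - C (2 * α)) * P) / y) y := by
  simp only [besselFunctional_apply]
  refine (hasDerivAt_macdonaldFunctional α _ hy).congr_deriv ?_
  congr 2
  simp [sub_mul, Algebra.algebraMap_eq_smul_one, mul_smul, smul_comm α]

open Polynomial in
lemma mul_besselFunctional (α : ℝ) (P : ℝ[X]) {y : ℝ} (hy : 0 < y) :
    y ^ 2 / 4 * besselFunctional α y P
      = besselFunctional α y (X * (X + C α) * P.comp (X + 1)) := by
  simp only [besselFunctional_apply]
  rw [mul_macdonaldFunctional α _ hy, aeval_raising_mul_X,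
    show X * (1 : ℝ[X]) = aeval raising (X : ℝ[X]) 1 by simp [raising_apply],
    show X * (X + C α) * P.comp (X + 1) = (X + C α) * (P.comp (X + 1) * X) by ring,
    map_mul (aeval raising) (X + C α), map_mul (aeval raising) (P.comp _)]
  simp [Algebra.algebraMap_eq_smul_one]

open Polynomial in
lemma besselFunctional_ascPochhammer (α y : ℝ) (k : ℕ) :
    besselFunctional α y (ascPochhammer ℝ k) = macdonald (k - α) (y ^ 2 / 4) := by
  have h : ∀ k : ℕ, aeval raising (ascPochhammer ℝ k) (1 : ℝ[X]) = monomial k 1 := by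
    intro k
    induction k with
    | zero => simp
    | succ k ih =>
      rw [ascPochhammer_succ_right, mul_comm, map_mul, Module.End.mul_apply, ih]
      simp [raising_monomial, smul_monomial]
  rw [besselFunctional_apply, h, macdonaldFunctional_monomial, mul_one]

open Polynomial in
lemma pow_mul_besselFunctional_one (α : ℝ) (n : ℕ) {y : ℝ} (hy : 0 < y) :
    (y / 2) ^ (2 * n) * besselFunctional α y 1
      = besselFunctional α y (ascPochhammer ℝ n * (ascPochhammer ℝ n).comp (X + C α)) := by
  induction n with
  | zero => simp
  | succ n ih =>
    rw [show (y / 2) ^ (2 * (n + 1)) = y ^ 2 / 4 * (y / 2) ^ (2 * n) by ring, mul_assoc, ih,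
      mul_besselFunctional α _ hy, ascPochhammer_succ_left]
    simp only [mul_comp, comp_assoc, X_comp, add_comp, C_comp, one_comp]
    congr 1
    rw [show (X + 1 + C α : ℝ[X]) = X + C α + 1 by ring]
    ring

lemma contDiff_tsum_mul_pow {a : ℕ → ℝ} (ha : ∀ n, a n ≠ 0)
    (h : Tendsto (fun n => ‖a (n + 1)‖ / ‖a n‖) atTop (𝓝 0)) (n : ℕ) :
    ContDiff ℝ n (fun w : ℝ => ∑' k, a k * w ^ k) := by
  have hr : (FormalMultilinearSeries.ofScalars ℝ a).radius = ⊤ :=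
    FormalMultilinearSeries.ofScalars_radius_eq_top_of_tendsto ℝ a (Eventually.of_forall ha) h
  have hs := (FormalMultilinearSeries.ofScalars ℝ a).hasFPowerSeriesOnBall (by simp [hr])
  rw [hr] at hs
  have he : (FormalMultilinearSeries.ofScalars ℝ a).sum = fun w : ℝ => ∑' k, a k * w ^ k := by
    change FormalMultilinearSeries.ofScalarsSum a = _
    simp [FormalMultilinearSeries.ofScalars_sum_eq, funext_iff]
  rw [← he, contDiff_iff_contDiffAt]
  exact fun x => (hs.analyticOnNhd x (by simp)).contDiffAt

lemma summable_mul_pow_of_ratio {a : ℕ → ℝ} (ha : ∀ n, a n ≠ 0)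
    (h : Tendsto (fun n => ‖a (n + 1)‖ / ‖a n‖) atTop (𝓝 0)) (w : ℝ) :
    Summable (fun k => a k * w ^ k) := by
  rcases eq_or_ne w 0 with rfl | hw
  · exact summable_of_ne_finset_zero (s := {0}) fun k hk => by simp_all
  refine summable_of_ratio_test_tendsto_lt_one zero_lt_one
    (Eventually.of_forall fun n => mul_ne_zero (ha n) (pow_ne_zero n hw)) ?_
  have h2 := h.mul_const ‖w‖
  rw [zero_mul] at h2
  refine h2.congr fun n => ?_
  have := norm_ne_zero_iff.2 hw
  simp only [norm_mul, norm_pow, pow_succ]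
  field_simp

lemma tildeI_eq_sum_add {β : ℝ} (hβ : -1 < β) (N : ℕ) :
    ∃ R : ℝ → ℝ, (∀ n : ℕ, ContDiff ℝ n R) ∧ ∀ z, tildeI β z
      = ∑ n ∈ Finset.range N, (z / 2) ^ (2 * n) / (n.factorial * Real.Gamma (n + β + 1))
        + (z / 2) ^ (2 * N) * R z := by
  set a : ℕ → ℝ := fun n => ((n.factorial : ℝ) * Real.Gamma (n + β + 1))⁻¹ with ha_def
  have hpos : ∀ n : ℕ, 0 < (n : ℝ) + β + 1 := fun n => by
    have : (0 : ℝ) ≤ n := n.cast_nonneg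
    linarith
  have hG : ∀ n : ℕ, 0 < Real.Gamma (n + β + 1) := fun n => Real.Gamma_pos_of_pos (hpos n)
  have ha : ∀ n, 0 < a n := fun n => by
    have := hG n
    positivity
  have hrat : ∀ n, ‖a (n + 1)‖ / ‖a n‖ = ((n : ℝ) + β + 1)⁻¹ * ((n : ℝ) + 1)⁻¹ := fun n => by
    have h1 := (hG n).ne'
    have h2 := (hpos n).ne'
    rw [Real.norm_of_nonneg (ha _).le, Real.norm_of_nonneg (ha _).le]
    simp only [ha_def]
    rw [show ((n + 1 : ℕ) : ℝ) + β + 1 = (n + β + 1) + 1 by push_cast; ring,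
      Real.Gamma_add_one h2, Nat.factorial_succ]
    push_cast
    field_simp
  have hlim : Tendsto (fun n => ‖a (n + 1)‖ / ‖a n‖) atTop (𝓝 0) := by
    simp only [hrat]
    have h1 : Tendsto (fun n : ℕ => ((n : ℝ) + β + 1)⁻¹) atTop (𝓝 0) := by
      refine tendsto_inv_atTop_zero.comp ?_
      simpa [add_assoc] using tendsto_atTop_add_const_right _ (β + 1)
        (tendsto_natCast_atTop_atTop (R := ℝ))
    have h2 : Tendsto (fun n : ℕ => ((n : ℝ) + 1)⁻¹) atTop (𝓝 0) := by
      simpa using tendsto_one_div_add_atTop_nhds_zero_nat (𝕜 := ℝ)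
    simpa using h1.mul h2
  have hlimN : Tendsto (fun n => ‖a (n + 1 + N)‖ / ‖a (n + N)‖) atTop (𝓝 0) := by
    simpa only [Function.comp_def, add_right_comm _ N 1] using
      hlim.comp (tendsto_add_atTop_nat N)
  refine ⟨fun z => ∑' k, a (k + N) * ((z / 2) ^ 2) ^ k, fun n => ?_, fun z => ?_⟩
  · exact (contDiff_tsum_mul_pow (fun n => (ha (n + N)).ne') hlimN n).comp
      ((contDiff_id.div_const 2).pow 2)
  · have h1 := (summable_mul_pow_of_ratio (fun n => (ha n).ne') hlim
      ((z / 2) ^ 2)).sum_add_tsum_nat_add N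
    have h2 : tildeI β z = ∑' k, a k * ((z / 2) ^ 2) ^ k := by
      unfold tildeI
      refine tsum_congr fun n => ?_
      rw [div_eq_mul_inv, mul_comm, pow_mul]
    rw [h2, ← h1, ← tsum_mul_left]
    congr 1
    · refine Finset.sum_congr rfl fun n _ => ?_
      rw [div_eq_mul_inv (_ ^ _), mul_comm (_ ^ _), pow_mul]
    · refine tsum_congr fun n => ?_
      rw [pow_add, pow_mul _ 2 N]
      ring

open Polynomial in
lemma hasDerivAt_rpow_mul_besselFunctional (α c : ℝ) (P : ℝ[X]) {x t : ℝ} (hx : 0 < x)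
    (ht : t < 1) :
    HasDerivAt (fun t => (1 - t) ^ (-c) * besselFunctional α (x / (1 - t)) P)
      ((1 - t) ^ (-(c + 1)) * besselFunctional α (x / (1 - t)) ((C (c - 2 * α) - C 2 * X) * P))
      t := by
  have h0 : 0 < 1 - t := by linarith
  have h1 : HasDerivAt (fun t : ℝ => 1 - t) (-1) t := by
    simpa using (hasDerivAt_id t).const_sub 1
  have h2 := h1.rpow_const (p := -c) (Or.inl h0.ne')
  have h3 : HasDerivAt (fun t : ℝ => x / (1 - t)) (x / (1 - t) ^ 2) t :=
    ((hasDerivAt_const t x).div h1 h0.ne').congr_deriv (by simp)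
  have h4 := (hasDerivAt_besselFunctional α P (div_pos hx h0)).comp t h3
  refine (h2.mul h4).congr_deriv ?_
  rw [show (C (c - 2 * α) - C 2 * X) * P = C c * P + (-C 2 * X - C (2 * α)) * P by
      rw [C_sub]; ring, map_add, ← smul_eq_C_mul, map_smul, smul_eq_mul,
    show -(c + 1) = -c - 1 by ring, Real.rpow_sub_one h0.ne']
  simp only [Function.comp_apply]
  field_simp

open Polynomial in
lemma contDiffOn_rpow_mul_besselFunctional (α c : ℝ) (P : ℝ[X]) {x : ℝ} (hx : 0 < x) (n : ℕ) :
    ContDiffOn ℝ n (fun t => (1 - t) ^ (-c) * besselFunctional α (x / (1 - t)) P) (Iio 1) := by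
  induction n generalizing c P with
  | zero =>
    exact contDiffOn_zero.2 fun t ht =>
      (hasDerivAt_rpow_mul_besselFunctional α c P hx ht).continuousAt.continuousWithinAt
  | succ n ih =>
    refine (contDiffOn_succ_iff_deriv_of_isOpen (n := n) isOpen_Iio).2 ⟨fun t ht =>
      (hasDerivAt_rpow_mul_besselFunctional α c P hx ht).differentiableAt.differentiableWithinAt,
      fun h => absurd h (by simp), ?_⟩
    exact (ih (c + 1) ((C (c - 2 * α) - C 2 * X) * P)).congr fun t ht =>
      (hasDerivAt_rpow_mul_besselFunctional α c P hx ht).deriv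

open Polynomial in
lemma iteratedDeriv_rpow_mul_besselFunctional (α c : ℝ) (P : ℝ[X]) {x : ℝ} (hx : 0 < x) (m : ℕ) :
    EqOn (iteratedDeriv m (fun t => (1 - t) ^ (-c) * besselFunctional α (x / (1 - t)) P))
      (fun t => (1 - t) ^ (-(c + m)) * besselFunctional α (x / (1 - t))
        ((ascPochhammer ℝ m).comp (C (c - 2 * α) - C 2 * X) * P)) (Iio 1) := by
  induction m with
  | zero => intro t _; simp
  | succ m ih =>
    intro t ht
    rw [iteratedDeriv_succ, Filter.EventuallyEq.deriv_eq
      (Filter.eventuallyEq_of_mem (isOpen_Iio.mem_nhds ht) ih),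
      (hasDerivAt_rpow_mul_besselFunctional α _ _ hx ht).deriv]
    simp only [Nat.cast_add, Nat.cast_one, ← add_assoc, ascPochhammer_succ_right, mul_comp,
      add_comp, X_comp, natCast_comp]
    congr 2
    simp only [C_sub, C_add, C_mul, map_natCast]
    ring

lemma iteratedDeriv_pow_mul_zero {h : ℝ → ℝ} {j k : ℕ} (hh : ContDiffAt ℝ j h 0) :
    iteratedDeriv j (fun t => t ^ k * h t) 0
      = if k ≤ j then j.factorial / (j - k).factorial * iteratedDeriv (j - k) h 0 else 0 := by
  have h1 := iteratedDeriv_mul (f := fun t : ℝ => t ^ k) (contDiffAt_id.pow k) hh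
  rw [show (fun t => t ^ k * h t) = (fun t : ℝ => t ^ k) * h from rfl, h1]
  simp only [iteratedDeriv_fun_pow_zero]
  split_ifs with hk
  · rw [Finset.sum_eq_single k (fun i _ hi => by simp [hi]) (fun h => by simp at h; omega)]
    rw [if_pos rfl, Nat.cast_choose ℝ hk]
    have := (k.factorial_pos).ne'
    field_simp
  · refine Finset.sum_eq_zero fun i hi => ?_
    have : i ≠ k := by simp at hi; omega
    simp [this]

open Polynomial in
/-- The polynomial representing `Λ₂ⱼ` under `besselFunctional`, as it arises from the Taylor
expansion of the generating function. -/
def taylorPoly (β α τ : ℝ) (j : ℕ) : ℝ[X] :=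
  ∑ n ∈ Finset.range (j + 1), if 2 * n ≤ j then
    (((j - 2 * n).factorial : ℝ) * (n.factorial * Real.Gamma (n + β + 1)))⁻¹ •
      ((ascPochhammer ℝ (j - 2 * n)).comp (C τ - C 2 * X) *
        (ascPochhammer ℝ n * (ascPochhammer ℝ n).comp (X + C α))) else 0

lemma Lambda₂_eq_besselFunctional {μ ν : ℝ} (hμ : 0 ≤ μ) (j : ℕ) {x : ℝ} (hx : 0 < x) :
    Lambda₂ μ ν j x
      = besselFunctional (ν / 2) x (taylorPoly (μ / 2) (ν / 2) ((μ - ν + 2) / 2) j) / 2 := by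
  obtain ⟨R, hR, hI⟩ := tildeI_eq_sum_add (β := μ / 2) (by linarith) (j + 1)
  set α := ν / 2 with hα
  set σ := (μ + ν + 2) / 2 with hσ
  set v : ℕ → Polynomial ℝ := fun n => ascPochhammer ℝ n *
    (ascPochhammer ℝ n).comp (Polynomial.X + Polynomial.C α) with hv
  set H : ℕ → ℝ → ℝ := fun n t => (1 - t) ^ (-σ) * besselFunctional α (x / (1 - t)) (v n) with hH
  set S : ℝ → ℝ := fun t => H (j + 1) t * R (t * x / (1 - t)) / 2 with hS
  have hHc : ∀ n, ContDiffAt ℝ j (H n) 0 := fun n =>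
    (contDiffOn_rpow_mul_besselFunctional α σ (v n) hx j).contDiffAt
      (isOpen_Iio.mem_nhds (by simp))
  have hSc : ContDiffAt ℝ j S 0 := by
    refine ((hHc _).mul ((hR j).contDiffAt.comp 0 ?_)).div_const 2
    exact (contDiffAt_id.mul contDiffAt_const).div (contDiffAt_const.sub contDiffAt_id) (by simp)
  have hG : (fun t => genG₂ μ ν t x) =ᶠ[𝓝 0] fun t =>
      ∑ n ∈ Finset.range (j + 1), (2 * (n.factorial * Real.Gamma (n + μ / 2 + 1)))⁻¹ *
        (t ^ (2 * n) * H n t) + t ^ (2 * (j + 1)) * S t := by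
    filter_upwards [isOpen_Iio.mem_nhds (show (0 : ℝ) ∈ Iio 1 by simp)] with t ht
    have ht : 0 < 1 - t := by simpa using ht
    have hy : 0 < x / (1 - t) := div_pos hx ht
    have hK : tildeK α (x / (1 - t)) = besselFunctional α (x / (1 - t)) 1 / 2 := by
      have := besselFunctional_ascPochhammer α (x / (1 - t)) 0
      simp only [ascPochhammer_zero, Nat.cast_zero, zero_sub] at this
      rw [tildeK_eq_macdonald _ hy, this]
    have hp : ∀ n, (t * x / (1 - t) / 2) ^ (2 * n) * besselFunctional α (x / (1 - t)) 1
        = t ^ (2 * n) * besselFunctional α (x / (1 - t)) (v n) := fun n => by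
      rw [hv, ← pow_mul_besselFunctional_one α n hy, ← mul_assoc, ← mul_pow]
      ring
    simp only [genG₂, hI, hS, hH]
    rw [show -(μ + ν + 2) / 2 = -σ by rw [hσ]; ring, ← hα, hK]
    have e1 := hp (j + 1)
    have e2 : ∀ n ∈ Finset.range (j + 1),
        (2 * (n.factorial * Real.Gamma (n + μ / 2 + 1)))⁻¹ *
          (t ^ (2 * n) * ((1 - t) ^ (-σ) * besselFunctional α (x / (1 - t)) (v n)))
        = ((t * x / (1 - t) / 2) ^ (2 * n) / (n.factorial * Real.Gamma (n + μ / 2 + 1))) *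
          ((1 - t) ^ (-σ) * besselFunctional α (x / (1 - t)) 1 / 2) := fun n _ => by
      rw [mul_inv, div_eq_mul_inv (_ ^ _)]
      linear_combination (-(2⁻¹ * (1 - t) ^ (-σ) *
        ((n.factorial : ℝ) * Real.Gamma (n + μ / 2 + 1))⁻¹)) * hp n
    rw [Finset.sum_congr rfl e2, ← Finset.sum_mul]
    linear_combination ((1 - t) ^ (-σ) * R (t * x / (1 - t)) / 2) * e1
  have hterm : ∀ n, ContDiffAt ℝ j (fun t : ℝ => t ^ (2 * n) * H n t) 0 := fun n =>
    (contDiffAt_id.pow _).mul (hHc n)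
  have hrem : ContDiffAt ℝ j (fun t : ℝ => t ^ (2 * (j + 1)) * S t) 0 :=
    (contDiffAt_id.pow _).mul hSc
  rw [Lambda₂, hG.iteratedDeriv_eq j, iteratedDeriv_fun_add
    (ContDiffAt.sum fun n _ => contDiffAt_const.mul (hterm n)) hrem,
    iteratedDeriv_fun_sum fun n _ => contDiffAt_const.mul (hterm n),
    iteratedDeriv_pow_mul_zero hSc, if_neg (by omega), add_zero, taylorPoly, map_sum,
    Finset.sum_div, Finset.sum_div]
  refine Finset.sum_congr rfl fun n _ => ?_
  rw [iteratedDeriv_const_mul _ (hterm n), iteratedDeriv_pow_mul_zero (hHc n)]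
  split_ifs with hn
  · rw [hH, iteratedDeriv_rpow_mul_besselFunctional α σ (v n) hx _ (by simp),
      map_smul, smul_eq_mul, show σ - 2 * α = (μ - ν + 2) / 2 by rw [hσ, hα]; ring]
    have := (j.factorial_pos).ne'
    simp only [sub_zero, Real.one_rpow, div_one, one_mul, hv]
    field_simp
  · simp

/-- The rising factorial `z (z + 1) ⋯ (z + n - 1)`. -/
def rising (z : ℝ) (n : ℕ) : ℝ := (ascPochhammer ℝ n).eval z

lemma rising_zero (z : ℝ) : rising z 0 = 1 := by simp [rising]

lemma rising_succ (z : ℝ) (n : ℕ) : rising z (n + 1) = rising z n * (z + n) :=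
  ascPochhammer_succ_eval n z

lemma rising_succ' (z : ℝ) (n : ℕ) : rising z (n + 1) = z * rising (z + 1) n := by
  simp [rising, ascPochhammer_succ_left]

lemma rising_pos {z : ℝ} (hz : 0 < z) (n : ℕ) : 0 < rising z n := ascPochhammer_pos n z hz

lemma Gamma_add_natCast {z : ℝ} (hz : 0 < z) (n : ℕ) :
    Real.Gamma (z + n) = rising z n * Real.Gamma z := by
  induction n with
  | zero => simp [rising_zero]
  | succ n ih =>
    rw [Nat.cast_succ, ← add_assoc, Real.Gamma_add_one (by positivity), ih, rising_succ]
    ring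

open PowerSeries in
lemma recurrence_mul_powerSeries {U V : PowerSeries ℝ} {c x a : ℝ}
    (hU : ∀ m : ℕ, (m + 1) * coeff (m + 1) U = (c + m) * coeff m U)
    (hV1 : coeff 1 V = 0)
    (hV : ∀ m : ℕ, (m + 2) * (m + 2 * (c + 2 * x + a)) * coeff (m + 2) V
      = (m + 2 * x) * (m + 2 * x + 2 * a) * coeff m V) (j : ℕ) :
    (j + 2) * (j + 2 * (c + 2 * x + a)) * coeff (j + 2) (U * V)
      = (2 * j + 2 * (c + 2 * x + a) + 1) * c * coeff (j + 1) (U * V)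
        + (j + c + 2 * x + 2 * a) * (j + c + 2 * x) * coeff j (U * V) := by
  have h1 : (1 - X) * d⁄dX ℝ U = C c * U := by
    ext m
    rcases m with _ | m
    · have h0 : constantCoeff (d⁄dX ℝ U) = coeff 1 U := by
        rw [← coeff_zero_eq_constantCoeff_apply, coeff_derivative]
        simp
      simpa [sub_mul, h0] using hU 0
    · have := hU (m + 1)
      simp only [sub_mul, one_mul, map_sub, coeff_succ_X_mul, coeff_derivative, coeff_C_mul]
      push_cast at *
      linarith
  have h2 : (1 - X) * d⁄dX ℝ (d⁄dX ℝ U) = (C c + 1) * d⁄dX ℝ U := by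
    have := congrArg (d⁄dX ℝ) h1
    simp only [Derivation.leibniz, map_sub, derivative_one, derivative_X, derivative_C,
      smul_eq_mul] at this
    linear_combination this
  obtain ⟨e, he⟩ : ∃ e, e = 1 + 4 * x + 2 * a := ⟨_, rfl⟩
  obtain ⟨f, hf⟩ : ∃ f, f = 1 + 2 * c + 4 * x + 2 * a := ⟨_, rfl⟩
  have h3 : X * d⁄dX ℝ (d⁄dX ℝ V) + C (2 * (c + 2 * x + a) - 1) * d⁄dX ℝ V
      = X * (X * (X * d⁄dX ℝ (d⁄dX ℝ V)) + C e * (X * d⁄dX ℝ V)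
        + C (4 * x * (x + a)) * V) := by
    ext m
    rcases m with _ | _ | _ | m
    · have h0 : constantCoeff (d⁄dX ℝ V) = 0 := by
        rw [← coeff_zero_eq_constantCoeff_apply, coeff_derivative]
        simpa using hV1
      simp [h0]
    · have := hV 0
      simp only [map_add, coeff_succ_X_mul, coeff_derivative, coeff_C_mul, coeff_zero_X_mul]
      push_cast at *
      rw [he]
      linarith
    · have := hV 1
      simp only [map_add, coeff_succ_X_mul, coeff_derivative, coeff_C_mul, coeff_zero_X_mul]
      push_cast at *
      rw [he]
      linarith
    · have := hV (m + 2)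
      simp only [map_add, coeff_succ_X_mul, coeff_derivative, coeff_C_mul]
      push_cast at *
      rw [he]
      linarith
  set Y := U * V with hY
  have h4 : X * d⁄dX ℝ (d⁄dX ℝ Y) + C (2 * (c + 2 * x + a) - 1) * d⁄dX ℝ Y
      = C (2 * c) * (X * d⁄dX ℝ Y) + C (c * (2 * (c + 2 * x + a) - 1)) * Y
        + X * (X * (X * d⁄dX ℝ (d⁄dX ℝ Y)) + C f * (X * d⁄dX ℝ Y)
        + C ((c + 2 * x) * (c + 2 * x + 2 * a)) * Y) := by
    have hX : (1 - X : PowerSeries ℝ) ^ 2 ≠ 0 := by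
      refine pow_ne_zero 2 fun h => ?_
      have := congrArg constantCoeff h
      simp at this
    refine mul_left_cancel₀ hX ?_
    have hC2 : (C (2 : ℝ) : PowerSeries ℝ) = 2 := map_ofNat C 2
    have hC4 : (C (4 : ℝ) : PowerSeries ℝ) = 4 := map_ofNat C 4
    simp only [hY, he, hf, Derivation.leibniz, smul_eq_mul, map_add, map_mul, map_sub, map_one,
      hC2, hC4] at h3 ⊢
    generalize d⁄dX ℝ (d⁄dX ℝ U) = U2 at *
    generalize d⁄dX ℝ (d⁄dX ℝ V) = V2 at *
    generalize d⁄dX ℝ U = U1 at *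
    generalize d⁄dX ℝ V = V1 at *
    linear_combination (X - X ^ 3) * (1 - X) * V * h2
      + ((X - X ^ 3) * V * (C c + 1) + (1 - X) * (2 * (X - X ^ 3) * V1
        + (2 * (C c + 2 * C x + C a) - 1 - 2 * C c * X
          - (1 + 2 * C c + 4 * C x + 2 * C a) * X ^ 2) * V)) * h1
      + U * (1 - X) ^ 2 * h3
  have h5 := congrArg (coeff (j + 1)) h4
  rcases j with _ | _ | j
  all_goals
    simp only [map_add, coeff_succ_X_mul, coeff_derivative, coeff_C_mul, coeff_zero_X_mul,
      zero_add] at h5 ⊢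
    push_cast at *
    rw [hf] at h5
    linarith

/-- The coefficient of the rising factorial `(X)_k` in the polynomial representing `Λ₂ⱼ`, up to
the factor `Γ(β + 1)⁻¹`. -/
def macdonaldCoeff (β τ : ℝ) (j k : ℕ) : ℝ :=
  (-1) ^ k * j.choose k * rising (j + 2 * β + 1) k * rising (τ + k) (j - k) /
    (j.factorial * rising (β + 1) k)

lemma macdonaldCoeff_of_lt (β τ : ℝ) {j k : ℕ} (h : j < k) : macdonaldCoeff β τ j k = 0 := by
  simp [macdonaldCoeff, Nat.choose_eq_zero_of_lt h]

lemma macdonaldCoeff_eq (β τ : ℝ) {j k d : ℕ} (h : j = k + d) :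
    macdonaldCoeff β τ j k = (-1) ^ k * rising (j + 2 * β + 1) k * rising (τ + k) d /
      (k.factorial * d.factorial * rising (β + 1) k) := by
  subst h
  rw [macdonaldCoeff, Nat.cast_choose ℝ (by omega), show k + d - k = d by omega]
  have h1 : ((k + d).factorial : ℝ) ≠ 0 := by exact_mod_cast (k + d).factorial_ne_zero
  field_simp

lemma macdonaldCoeff_zero_right (β τ : ℝ) (j : ℕ) :
    macdonaldCoeff β τ j 0 = rising τ j / j.factorial := by
  rw [macdonaldCoeff_eq β τ (zero_add j).symm]
  simp [rising_zero]

lemma macdonaldCoeff_recurrence_zero (β τ : ℝ) (j : ℕ) :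
    (j + 2) * (j + 2 * β + 2) * macdonaldCoeff β τ (j + 2) 0
      = (2 * j + 2 * β + 3) * (τ * macdonaldCoeff β τ (j + 1) 0)
        + (j + 2 * β + 2 - τ) * (j + τ) * macdonaldCoeff β τ j 0 := by
  have h1 : (j.factorial : ℝ) ≠ 0 := by exact_mod_cast j.factorial_ne_zero
  simp only [macdonaldCoeff_zero_right, Nat.factorial_succ, rising_succ]
  push_cast
  field_simp
  ring

lemma macdonaldCoeff_recurrence {β : ℝ} (hβ : 0 ≤ β) (τ : ℝ) (j k : ℕ) :
    (j + 2) * (j + 2 * β + 2) * macdonaldCoeff β τ (j + 2) (k + 1)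
      = (2 * j + 2 * β + 3) * ((τ + 2 * (k + 1)) * macdonaldCoeff β τ (j + 1) (k + 1)
          - 2 * macdonaldCoeff β τ (j + 1) k)
        + (j + 2 * β + 2 - τ) * (j + τ) * macdonaldCoeff β τ j (k + 1) := by
  have hk : (k.factorial : ℝ) ≠ 0 := by exact_mod_cast k.factorial_ne_zero
  have hb : β + 1 + k ≠ 0 := by positivity
  have hr := (rising_pos (show 0 < β + 1 by positivity) k).ne'
  obtain ⟨s, hs⟩ : ∃ s, s = (j : ℝ) + 2 * β + 2 := ⟨_, rfl⟩
  have hs0 : s ≠ 0 := by rw [hs]; positivity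
  have hB : rising (s + 1) k = rising s k * (s + k) / s := by
    rw [eq_div_iff hs0, mul_comm, ← rising_succ', rising_succ]
  have e2 : rising ((j + 2 : ℕ) + 2 * β + 1) (k + 1) = rising s k * (s + k) / s * (s + 1 + k) := by
    rw [← hB, ← rising_succ, hs]
    push_cast
    ring_nf
  have e1 : ((j + 1 : ℕ) : ℝ) + 2 * β + 1 = s := by
    rw [hs]
    push_cast
    ring
  have e0 : rising (j + 2 * β + 1) (k + 1) = (s - 1) * rising s k := by
    rw [rising_succ', show (j : ℝ) + 2 * β + 1 = s - 1 by rw [hs]; ring, sub_add_cancel]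
  rcases lt_or_ge j k with h | h
  · rw [macdonaldCoeff_of_lt β τ (show j + 1 < k + 1 by omega),
      macdonaldCoeff_of_lt β τ (show j < k + 1 by omega)]
    rcases eq_or_lt_of_le (Nat.succ_le_of_lt h) with h | h
    · have hj : (j : ℝ) = k - 1 := by rw [← h]; simp
      rw [macdonaldCoeff_eq β τ (show j + 2 = k + 1 + 0 by omega),
        macdonaldCoeff_eq β τ (show j + 1 = k + 0 by omega), e2, e1]
      simp only [rising_zero, Nat.factorial_zero, Nat.factorial_succ k, pow_succ, rising_succ]
      rw [hj] at hs ⊢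
      push_cast
      field_simp
      rw [hs]
      ring
    · rw [macdonaldCoeff_of_lt β τ (show j + 2 < k + 1 by omega),
        macdonaldCoeff_of_lt β τ (show j + 1 < k by omega)]
      simp
  rcases eq_or_lt_of_le h with h | h
  · have hj : (j : ℝ) = k := by rw [h]
    rw [macdonaldCoeff_of_lt β τ (show j < k + 1 by omega),
      macdonaldCoeff_eq β τ (show j + 2 = k + 1 + (0 + 1) by omega),
      macdonaldCoeff_eq β τ (show j + 1 = k + 1 + 0 by omega),
      macdonaldCoeff_eq β τ (show j + 1 = k + (0 + 1) by omega), e2, e1]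
    simp only [rising_zero, Nat.factorial_zero, Nat.factorial_succ, pow_succ, rising_succ]
    rw [hj] at hs ⊢
    push_cast
    field_simp
    rw [hs]
    ring
  obtain ⟨d, hd⟩ := Nat.exists_eq_add_of_le h
  have hj : (j : ℝ) = k + 1 + d := by rw [hd]; push_cast; ring
  have hd0 : (d.factorial : ℝ) ≠ 0 := by exact_mod_cast d.factorial_ne_zero
  rw [macdonaldCoeff_eq β τ (show j + 2 = k + 1 + (d + 1 + 1) by omega),
    macdonaldCoeff_eq β τ (show j + 1 = k + 1 + (d + 1) by omega),
    macdonaldCoeff_eq β τ (show j + 1 = k + (d + 1 + 1) by omega),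
    macdonaldCoeff_eq β τ (show j = k + 1 + d by omega), e2, e1, e0, rising_succ' (τ + k),
    show τ + (k : ℝ) + 1 = τ + (k + 1 : ℕ) by push_cast; ring]
  simp only [Nat.factorial_succ, pow_succ, rising_succ]
  rw [hj] at hs ⊢
  push_cast
  field_simp
  rw [hs]
  ring

lemma sum_macdonaldCoeff_recurrence {β : ℝ} (hβ : 0 ≤ β) (τ x : ℝ) (j : ℕ) :
    (j + 2) * (j + 2 * β + 2) *
        ∑ k ∈ Finset.range (j + 3), macdonaldCoeff β τ (j + 2) k * rising x k
      = (2 * j + 2 * β + 3) * (τ - 2 * x) *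
          ∑ k ∈ Finset.range (j + 2), macdonaldCoeff β τ (j + 1) k * rising x k
        + (j + 2 * β + 2 - τ) * (j + τ) *
          ∑ k ∈ Finset.range (j + 1), macdonaldCoeff β τ j k * rising x k := by
  have h1 : ∑ k ∈ Finset.range (j + 1), macdonaldCoeff β τ j k * rising x k
      = ∑ k ∈ Finset.range (j + 3), macdonaldCoeff β τ j k * rising x k := by
    simp [Finset.sum_range_succ, macdonaldCoeff_of_lt]
  have h2 : (τ - 2 * x) * ∑ k ∈ Finset.range (j + 2), macdonaldCoeff β τ (j + 1) k * rising x k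
      = ∑ k ∈ Finset.range (j + 3), (τ + 2 * k) * macdonaldCoeff β τ (j + 1) k * rising x k
        - 2 * ∑ k ∈ Finset.range (j + 2), macdonaldCoeff β τ (j + 1) k * rising x (k + 1) := by
    rw [Finset.sum_range_succ _ (j + 2), macdonaldCoeff_of_lt β τ (show j + 1 < j + 2 by omega),
      mul_zero, zero_mul, add_zero, Finset.mul_sum, Finset.mul_sum, ← Finset.sum_sub_distrib]
    refine Finset.sum_congr rfl fun k _ => ?_
    rw [rising_succ]
    ring
  rw [h1, mul_assoc (2 * (j : ℝ) + 2 * β + 3), h2]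
  have h3 := macdonaldCoeff_recurrence_zero β τ j
  have h4 : ∀ k ∈ Finset.range (j + 2), (j + 2) * (j + 2 * β + 2) *
      (macdonaldCoeff β τ (j + 2) (k + 1) * rising x (k + 1))
      = (2 * j + 2 * β + 3) * ((τ + 2 * (k + 1 : ℕ)) * macdonaldCoeff β τ (j + 1) (k + 1)
          * rising x (k + 1))
        - (2 * j + 2 * β + 3) * (2 * (macdonaldCoeff β τ (j + 1) k * rising x (k + 1)))
        + (j + 2 * β + 2 - τ) * (j + τ) * (macdonaldCoeff β τ j (k + 1) * rising x (k + 1)) := by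
    intro k _
    push_cast
    linear_combination rising x (k + 1) * macdonaldCoeff_recurrence hβ τ j k
  have h5 := Finset.sum_congr rfl h4
  rw [Finset.sum_add_distrib, Finset.sum_sub_distrib] at h5
  simp only [← Finset.mul_sum] at h5
  simp only [Finset.sum_range_succ' _ (j + 2)]
  push_cast at h5 ⊢
  linear_combination h5 + rising x 0 * h3

open Polynomial in
lemma taylorPoly_eq {β : ℝ} (hβ : 0 ≤ β) (α : ℝ) (j : ℕ) :
    taylorPoly β α (β - α + 1) j = ∑ k ∈ Finset.range (j + 1),
      (macdonaldCoeff β (β - α + 1) j k / Real.Gamma (β + 1)) • ascPochhammer ℝ k := by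
  obtain ⟨τ, hτ⟩ : ∃ τ, τ = β - α + 1 := ⟨_, rfl⟩
  rw [← hτ]
  refine Polynomial.funext fun x => ?_
  have hG := (Real.Gamma_pos_of_pos (show 0 < β + 1 by positivity)).ne'
  set U : PowerSeries ℝ := PowerSeries.mk fun m => rising (τ - 2 * x) m / m.factorial with hU
  set V : PowerSeries ℝ := PowerSeries.mk fun m => if Even m then
    rising x (m / 2) * rising (x + α) (m / 2) / ((m / 2).factorial * rising (β + 1) (m / 2))
    else 0 with hV
  have hrec := recurrence_mul_powerSeries (U := U) (V := V) (c := τ - 2 * x) (x := x) (a := α)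
    (fun m => by
      have : (m.factorial : ℝ) ≠ 0 := by exact_mod_cast m.factorial_ne_zero
      simp only [hU, PowerSeries.coeff_mk, rising_succ, Nat.factorial_succ]
      push_cast
      field_simp) (by simp [hV]) (fun m => by
      simp only [hV, PowerSeries.coeff_mk]
      rcases Nat.even_or_odd' m with ⟨n, rfl | rfl⟩
      · have h1 : (n.factorial : ℝ) ≠ 0 := by exact_mod_cast n.factorial_ne_zero
        have h2 := (rising_pos (show 0 < β + 1 by positivity) n).ne'
        have h3 : β + 1 + n ≠ 0 := by positivity
        rw [if_pos (by simp [parity_simps]), if_pos (by simp), show (2 * n + 2) / 2 = n + 1 by omega,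
          show 2 * n / 2 = n by omega]
        simp only [rising_succ, Nat.factorial_succ, hτ]
        push_cast
        field_simp
        ring
      · rw [if_neg (by simp [parity_simps]), if_neg (by simp [parity_simps])]
        simp)
  have hp : ∀ j, (taylorPoly β α τ j).eval x * Real.Gamma (β + 1)
      = PowerSeries.coeff j (U * V) := by
    intro j
    rw [mul_comm U, PowerSeries.coeff_mul, Finset.Nat.sum_antidiagonal_eq_sum_range_succ_mk,
      taylorPoly, eval_finsetSum, Finset.sum_mul]
    simp only [hU, hV, PowerSeries.coeff_mk, ite_mul, zero_mul]
    rw [← Finset.sum_filter]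
    have h0 : ∀ n ∈ Finset.range (j + 1), eval x (if 2 * n ≤ j then
        (((j - 2 * n).factorial : ℝ) * (n.factorial * Real.Gamma (n + β + 1)))⁻¹ •
          ((ascPochhammer ℝ (j - 2 * n)).comp (C τ - C 2 * X) *
            (ascPochhammer ℝ n * (ascPochhammer ℝ n).comp (X + C α))) else 0)
          * Real.Gamma (β + 1)
        = if 2 * n ≤ j then rising x n * rising (x + α) n / (n.factorial * rising (β + 1) n) *
          (rising (τ - 2 * x) (j - 2 * n) / (j - 2 * n).factorial) else 0 := by
      intro n _
      split_ifs
      · have h1 : (n.factorial : ℝ) ≠ 0 := by exact_mod_cast n.factorial_ne_zero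
        have h2 := (rising_pos (show 0 < β + 1 by positivity) n).ne'
        rw [show (n : ℝ) + β + 1 = β + 1 + n by ring, Gamma_add_natCast (by positivity)]
        simp only [eval_smul, eval_mul, eval_comp, eval_sub, eval_add, eval_C, eval_X,
          smul_eq_mul, ← rising.eq_1]
        field_simp
      · simp
    rw [Finset.sum_congr rfl h0, ← Finset.sum_filter]
    refine Finset.sum_nbij' (fun n => 2 * n) (fun m => m / 2) ?_ ?_ ?_ ?_ ?_
    · intro n hn
      simp only [Finset.mem_filter, Finset.mem_range] at hn ⊢
      exact ⟨by omega, by simp⟩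
    · intro m hm
      simp only [Finset.mem_filter, Finset.mem_range] at hm ⊢
      omega
    · intro n _
      omega
    · intro m hm
      simp only [Finset.mem_filter] at hm
      have := hm.2.two_dvd
      omega
    · intro n _
      simp
  have hr : ∀ j, PowerSeries.coeff j (U * V)
      = ∑ k ∈ Finset.range (j + 1), macdonaldCoeff β τ j k * rising x k := by
    intro j
    induction j using Nat.twoStepInduction with
    | zero => simp [macdonaldCoeff, rising_zero, hU, hV]
    | one =>
      simp [macdonaldCoeff, rising_zero, hU, hV, PowerSeries.coeff_mul, Finset.sum_range_succ,
        Finset.Nat.antidiagonal_succ, rising_succ]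
      field_simp
      ring
    | more j h0 h1 =>
      have hne : ((j : ℝ) + 2) * (j + 2 * β + 2) ≠ 0 := by positivity
      refine mul_left_cancel₀ hne ?_
      rw [sum_macdonaldCoeff_recurrence hβ, ← h0, ← h1]
      have := hrec j
      rw [show τ - 2 * x + 2 * x + α = β + 1 by rw [hτ]; ring] at this
      rw [show (j : ℝ) + 2 * β + 2 = j + 2 * (β + 1) by ring, this]
      rw [hτ]
      ring
  rw [← mul_left_inj' hG, hp, hr, eval_finsetSum, Finset.sum_mul]
  refine Finset.sum_congr rfl fun k _ => ?_
  rw [eval_smul, smul_eq_mul, rising]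
  field_simp

lemma sum_neg_one_pow_mul_choose_mul (f : ℝ → ℝ) (j : ℕ) (y : ℝ) :
    ∑ k ∈ Finset.range (j + 1), (-1) ^ k * (j.choose k : ℝ) * f (y + k)
      = (-1) ^ j * (fwdDiff 1)^[j] f y := by
  rw [fwdDiff_iter_eq_sum_shift, Finset.mul_sum]
  refine Finset.sum_congr rfl fun k hk => ?_
  have hk : k ≤ j := by simpa [Nat.lt_succ_iff] using hk
  have h : ((-1 : ℝ)) ^ j * (-1) ^ (j - k) = (-1) ^ k := by
    obtain ⟨d, rfl⟩ := Nat.exists_eq_add_of_le hk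
    rw [show k + d - k = d by omega, pow_add, mul_assoc, ← pow_add, Even.neg_one_pow ⟨d, rfl⟩,
      mul_one]
  rw [zsmul_eq_mul, ← h, nsmul_one]
  push_cast
  ring

lemma sum_neg_one_pow_mul_choose_mul_eval {P : Polynomial ℝ} {j : ℕ} (h : P.natDegree < j) :
    ∑ k ∈ Finset.range (j + 1), (-1) ^ k * (j.choose k : ℝ) * P.eval (k : ℝ) = 0 := by
  have := sum_neg_one_pow_mul_choose_mul (fun x => P.eval x) j 0
  rw [Polynomial.fwdDiff_iter_eq_zero_of_degree_lt h] at this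
  simpa using this

lemma sum_neg_one_pow_mul_choose_div {z : ℝ} (hz : 0 < z) (j : ℕ) :
    ∑ k ∈ Finset.range (j + 1), (-1) ^ k * (j.choose k : ℝ) * (z + k)⁻¹
      = j.factorial / rising z (j + 1) := by
  have key : ∀ j : ℕ, ∀ y : ℝ, 0 < y →
      (fwdDiff 1)^[j] (fun x : ℝ => x⁻¹) y = (-1) ^ j * j.factorial / rising y (j + 1) := by
    intro j
    induction j with
    | zero =>
      intro y _
      simp [rising_succ, rising_zero]
    | succ j ih =>
      intro y hy
      rw [Function.iterate_succ_apply', fwdDiff, ih y hy, ih (y + 1) (by positivity)]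
      have h1 := (rising_pos (show 0 < y + 1 by positivity) j).ne'
      have h2 : y + 1 + j ≠ 0 := by positivity
      rw [rising_succ' y, rising_succ' y, rising_succ (y + 1), Nat.factorial_succ]
      push_cast
      field_simp
      ring
  rw [sum_neg_one_pow_mul_choose_mul (fun x => x⁻¹) j z, key j z hz, mul_div_assoc, ← mul_assoc,
    ← pow_add, Even.neg_one_pow ⟨j, rfl⟩, one_mul]

open Polynomial in
lemma sum_neg_one_pow_mul_choose_mul_eval_div {P : ℝ[X]} {j : ℕ} (h : P.natDegree ≤ j) {z : ℝ}
    (hz : 0 < z) :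
    ∑ k ∈ Finset.range (j + 1), (-1) ^ k * (j.choose k : ℝ) * (P.eval (k : ℝ) * (z + k)⁻¹)
      = P.eval (-z) * (j.factorial / rising z (j + 1)) := by
  rw [← sum_neg_one_pow_mul_choose_div hz]
  set Q := P /ₘ (X - C (-z)) with hQ
  have hPQ (x : ℝ) : P.eval x = (z + x) * Q.eval x + P.eval (-z) := by
    have := congrArg (eval x) (X_sub_C_mul_divByMonic_eq_sub_modByMonic P (-z))
    rw [modByMonic_X_sub_C_eq_C_eval] at this
    simp only [eval_mul, eval_sub, eval_X, eval_C, ← hQ] at this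
    linear_combination -this
  have hs : ∑ k ∈ Finset.range (j + 1), (-1) ^ k * (j.choose k : ℝ) * Q.eval (k : ℝ) = 0 := by
    rcases j with _ | j
    · have : Q = 0 := by
        rw [hQ, divByMonic_eq_zero_iff (monic_X_sub_C _), degree_X_sub_C]
        exact (natDegree_le_iff_degree_le.1 h).trans_lt (by norm_num)
      simp [this]
    · refine sum_neg_one_pow_mul_choose_mul_eval ?_
      rw [hQ, natDegree_divByMonic _ (monic_X_sub_C _), natDegree_X_sub_C]
      omega
  rw [Finset.mul_sum, ← sub_eq_zero, ← Finset.sum_sub_distrib, ← hs]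
  refine Finset.sum_congr rfl fun k _ => ?_
  have : z + k ≠ 0 := by positivity
  rw [hPQ k]
  field_simp
  ring

lemma rising_neg_sub (σ : ℝ) (j : ℕ) : rising (1 - j - σ) j = (-1) ^ j * rising σ j := by
  induction j generalizing σ with
  | zero => simp [rising_zero]
  | succ j ih =>
    rw [rising_succ, show 1 - ((j + 1 : ℕ) : ℝ) - σ = 1 - j - (σ + 1) by push_cast; ring, ih,
      rising_succ' σ]
    ring

/-- The numerators of `macdonaldCoeff` are such that, for every index `k ≤ j` whose coefficient
does not vanish, the Gamma factors of the associated integrals are positive. -/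
def NonvanishingIndicesPos (τ : ℝ) (j : ℕ) : Prop :=
  ∀ k ≤ j, rising (τ + k) (j - k) = 0 ∨ 0 < τ + k

lemma rising_mul_Gamma_eq {τ : ℝ} {j k l : ℕ} (h : NonvanishingIndicesPos τ j) (hk : k ≤ j)
    (hl : 0 < τ + l) :
    rising (τ + k) (j - k) * Real.Gamma (τ + k + l) = Real.Gamma (τ + j) * rising (τ + k) l := by
  rcases lt_or_ge 0 (τ + k) with hpos | hneg
  · have : τ + j = τ + k + (j - k : ℕ) := by
      push_cast [hk]
      ring
    rw [this, Gamma_add_natCast hpos, Gamma_add_natCast hpos]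
    ring
  · have h0 := (h k hk).resolve_right hneg.not_gt
    rw [h0, zero_mul]
    obtain ⟨m, hm, hm'⟩ := (ascPochhammer_eval_eq_zero_iff _ _).1 h0
    have hml : m < l := by
      by_contra! hlm
      obtain ⟨d, rfl⟩ := Nat.exists_eq_add_of_le hlm
      push_cast at hm'
      have : (0 : ℝ) ≤ d + k := by positivity
      linarith
    rw [rising, (ascPochhammer_eval_eq_zero_iff _ _).2 ⟨m, hml, hm'⟩, mul_zero]

open Polynomial in
lemma sum_macdonaldCoeff_mul_Gamma_div {β τ : ℝ} (hβ : 0 ≤ β) {j l : ℕ}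
    (h : NonvanishingIndicesPos τ j) (hlj : l ≤ j) (hl : 0 < τ + l) :
    ∑ k ∈ Finset.range (j + 1), (-1) ^ k * j.choose k * rising (j + 2 * β + 1) k *
        rising (τ + k) (j - k) * Real.Gamma (τ + k + l) / Real.Gamma (2 * β + 2 + k + l)
      = if l = j then (-1) ^ j * rising (2 * β + 2 - τ) j * j.factorial * Real.Gamma (τ + j) /
          (Real.Gamma (j + 2 * β + 1) * rising (j + 2 * β + 1) (j + 1)) else 0 := by
  set z : ℝ := j + 2 * β + 1 with hz
  have hz0 : 0 < z := by positivity
  have hG := (Real.Gamma_pos_of_pos hz0).ne'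
  have hdeg (n : ℕ) (c : ℝ) : ((ascPochhammer ℝ n).comp (X + C c)).natDegree = n := by
    rw [natDegree_comp, ascPochhammer_natDegree, natDegree_X_add_C, mul_one]
  split_ifs with hj
  · subst hj
    have h1 := sum_neg_one_pow_mul_choose_mul_eval_div (hdeg l τ).le hz0
    simp only [eval_comp, eval_add, eval_X, eval_C] at h1
    rw [show -z + τ = 1 - l - (2 * β + 2 - τ) by rw [hz]; ring, ← rising.eq_1, rising_neg_sub] at h1
    have h2 : (-1) ^ l * rising (2 * β + 2 - τ) l * l.factorial * Real.Gamma (τ + l) /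
          (Real.Gamma z * rising z (l + 1))
        = Real.Gamma (τ + l) / Real.Gamma z *
          ((-1) ^ l * rising (2 * β + 2 - τ) l * (l.factorial / rising z (l + 1))) := by
      field_simp
    rw [h2, ← h1, Finset.mul_sum]
    refine Finset.sum_congr rfl fun k hk => ?_
    have hk : k ≤ l := by simpa [Nat.lt_succ_iff] using hk
    have hzk : 0 < z + k := by positivity
    rw [mul_assoc _ (rising (τ + k) _), rising_mul_Gamma_eq h hk hl,
      show 2 * β + 2 + (k : ℝ) + l = z + k + 1 by rw [hz]; ring, Real.Gamma_add_one hzk.ne',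
      Gamma_add_natCast hz0, add_comm (k : ℝ) τ, ← rising.eq_1]
    have := (rising_pos hz0 k).ne'
    field_simp
  · obtain ⟨d, hd⟩ := Nat.exists_eq_add_of_lt (lt_of_le_of_ne hlj hj)
    have h1 : ((ascPochhammer ℝ l).comp (X + C τ) *
        (ascPochhammer ℝ d).comp (X + C (2 * β + 2 + l))).natDegree < j := by
      refine natDegree_mul_le.trans_lt ?_
      rw [hdeg, hdeg]
      omega
    have h2 := sum_neg_one_pow_mul_choose_mul_eval h1
    rw [← mul_zero (Real.Gamma (τ + j) / Real.Gamma z), ← h2, Finset.mul_sum]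
    refine Finset.sum_congr rfl fun k hk => ?_
    have hk : k ≤ j := by simpa [Nat.lt_succ_iff] using hk
    have hw : 0 < 2 * β + 2 + (k : ℝ) + l := by positivity
    have h3 : rising z k * Real.Gamma z
        = rising (k + (2 * β + 2 + l)) d * Real.Gamma (2 * β + 2 + k + l) := by
      rw [← Gamma_add_natCast hz0, show (k : ℝ) + (2 * β + 2 + l) = 2 * β + 2 + k + l by ring,
        ← Gamma_add_natCast hw]
      congr 1
      rw [hz, hd]
      push_cast
      ring
    have h4 := (Real.Gamma_pos_of_pos hw).ne'
    rw [mul_assoc _ (rising (τ + k) _), rising_mul_Gamma_eq h hk hl, eval_mul, eval_comp, eval_comp]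
    simp only [eval_add, eval_X, eval_C, ← rising.eq_1]
    rw [add_comm (k : ℝ) τ]
    generalize Real.Gamma (2 * β + 2 + k + l) = G at h3 h4 ⊢
    generalize rising (k + (2 * β + 2 + l)) d = R at h3 ⊢
    field_simp
    linear_combination j.choose k * Real.Gamma (τ + j) * rising (τ + k) l * h3

lemma sum_sum_macdonaldCoeff {β τ : ℝ} (hβ : 0 ≤ β) {j : ℕ} (h : NonvanishingIndicesPos τ j) :
    ∑ l ∈ Finset.range (j + 1), ∑ k ∈ Finset.range (j + 1),
        macdonaldCoeff β τ j k / Real.Gamma (β + 1) * (macdonaldCoeff β τ j l / Real.Gamma (β + 1)) *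
          (Real.Gamma (β + 1 + k) * Real.Gamma (β + 1 + l) * Real.Gamma (τ + k + l) /
            Real.Gamma (2 * β + 2 + k + l))
      = rising (2 * β + 2 - τ) j * Real.Gamma (τ + j) /
          (j.factorial * (2 * j + 2 * β + 1) * Real.Gamma (j + 2 * β + 1)) := by
  have hb : 0 < β + 1 := by positivity
  have hj : (j.factorial : ℝ) ≠ 0 := by exact_mod_cast j.factorial_ne_zero
  have hz0 : (0 : ℝ) < j + 2 * β + 1 := by positivity
  have h1 : ∀ l ∈ Finset.range (j + 1), ∑ k ∈ Finset.range (j + 1),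
        macdonaldCoeff β τ j k / Real.Gamma (β + 1) * (macdonaldCoeff β τ j l / Real.Gamma (β + 1)) *
          (Real.Gamma (β + 1 + k) * Real.Gamma (β + 1 + l) * Real.Gamma (τ + k + l) /
            Real.Gamma (2 * β + 2 + k + l))
      = (-1) ^ l * j.choose l * rising (j + 2 * β + 1) l * rising (τ + l) (j - l) /
          j.factorial ^ 2 *
        if l = j then (-1) ^ j * rising (2 * β + 2 - τ) j * j.factorial * Real.Gamma (τ + j) /
          (Real.Gamma (j + 2 * β + 1) * rising (j + 2 * β + 1) (j + 1)) else 0 := by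
    intro l hl
    have hl : l ≤ j := by simpa [Nat.lt_succ_iff] using hl
    rcases h l hl with h0 | h0
    · simp [macdonaldCoeff, h0]
    rw [← sum_macdonaldCoeff_mul_Gamma_div hβ h hl h0, Finset.mul_sum]
    refine Finset.sum_congr rfl fun k _ => ?_
    rw [Gamma_add_natCast hb, Gamma_add_natCast hb, macdonaldCoeff, macdonaldCoeff]
    have := (rising_pos hb k).ne'
    have := (rising_pos hb l).ne'
    have := (Real.Gamma_pos_of_pos hb).ne'
    have := (Real.Gamma_pos_of_pos (show 0 < 2 * β + 2 + (k : ℝ) + l by positivity)).ne'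
    field_simp
  rw [Finset.sum_congr rfl h1]
  simp only [mul_ite, mul_zero, Finset.sum_ite_eq', Finset.mem_range, Nat.lt_succ_self, if_true]
  rw [rising_succ, Nat.choose_self, Nat.sub_self, rising_zero]
  have h2 := (rising_pos hz0 j).ne'
  have h3 := (Real.Gamma_pos_of_pos hz0).ne'
  have h4 : (j : ℝ) + 2 * β + 1 + j ≠ 0 := by positivity
  have h5 : 2 * (j : ℝ) + 2 * β + 1 ≠ 0 := by positivity
  have h6 : ((-1 : ℝ) ^ j) ^ 2 = 1 := by rw [← pow_mul, mul_comm, pow_mul]; simp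
  push_cast
  field_simp
  rw [h6]
  ring

lemma Lambda₂_eq_sum {μ : ℝ} (hμ : 0 ≤ μ) (ν : ℝ) (j : ℕ) {x : ℝ} (hx : 0 < x) :
    Lambda₂ μ ν j x = (∑ k ∈ Finset.range (j + 1), macdonaldCoeff (μ / 2) ((μ - ν + 2) / 2) j k /
      Real.Gamma (μ / 2 + 1) * macdonald (k - ν / 2) (x ^ 2 / 4)) / 2 := by
  rw [Lambda₂_eq_besselFunctional hμ j hx,
    show (μ - ν + 2) / 2 = μ / 2 - ν / 2 + 1 by ring, taylorPoly_eq (by positivity), map_sum]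
  simp only [map_smul, besselFunctional_ascPochhammer, smul_eq_mul]

lemma integrableOn_and_integral_macdonaldCoeff_mul {β τ σ : ℝ} (hβ : 0 ≤ β) (hσ : 0 < σ)
    (hτ : σ + τ = 2 * β + 2) {j : ℕ} (h : NonvanishingIndicesPos τ j) {k l : ℕ} (hk : k ≤ j)
    (hl : l ≤ j) (c : ℝ) :
    IntegrableOn (fun x : ℝ => macdonaldCoeff β τ j k / c * (macdonaldCoeff β τ j l / c) *
        (macdonald (k - (σ - β - 1)) (x ^ 2 / 4) * macdonald (l - (σ - β - 1)) (x ^ 2 / 4) *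
          x ^ (2 * σ - 1))) (Ioi 0) ∧
      ∫ x in Ioi (0 : ℝ), macdonaldCoeff β τ j k / c * (macdonaldCoeff β τ j l / c) *
        (macdonald (k - (σ - β - 1)) (x ^ 2 / 4) * macdonald (l - (σ - β - 1)) (x ^ 2 / 4) *
          x ^ (2 * σ - 1))
      = 2 ^ (2 * σ - 1) * Real.Gamma σ *
        (macdonaldCoeff β τ j k / c * (macdonaldCoeff β τ j l / c) *
          (Real.Gamma (β + 1 + k) * Real.Gamma (β + 1 + l) * Real.Gamma (τ + k + l) /
            Real.Gamma (2 * β + 2 + k + l))) := by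
  rcases h k hk with h0 | h0
  · simp [macdonaldCoeff, h0]
  rcases h l hl with h1 | h1
  · simp [macdonaldCoeff, h1]
  have e1 : σ + (k - (σ - β - 1)) = β + 1 + k := by ring
  have e2 : σ + (l - (σ - β - 1)) = β + 1 + l := by ring
  have e3 : σ + (k - (σ - β - 1)) + (l - (σ - β - 1)) = τ + k + l := by linarith
  have e4 : 2 * σ + (k - (σ - β - 1)) + (l - (σ - β - 1)) = 2 * β + 2 + k + l := by ring
  obtain ⟨hi, hI⟩ := integrableOn_and_integral_macdonald_mul_macdonald hσ
    (a := k - (σ - β - 1)) (b := l - (σ - β - 1)) (by rw [e1]; positivity)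
    (by rw [e2]; positivity) (by rw [e3]; positivity)
  refine ⟨hi.const_mul _, ?_⟩
  rw [integral_const_mul, hI, e3, e1, e2, e4]
  ring

lemma integral_Lambda₂_sq {μ ν : ℝ} (hμ : 0 ≤ μ) (hσ : 0 < μ + ν + 2) {j : ℕ}
    (h : NonvanishingIndicesPos ((μ - ν + 2) / 2) j) :
    ∫ x in Ioi (0 : ℝ), Lambda₂ μ ν j x ^ 2 * x ^ (μ + ν + 1)
      = 2 ^ (μ + ν - 1) * Real.Gamma ((j : ℝ) + (μ + ν + 2) / 2) *
          Real.Gamma ((j : ℝ) + (μ - ν + 2) / 2) /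
        ((j.factorial : ℝ) * (2 * (j : ℝ) + μ + 1) * Real.Gamma ((j : ℝ) + μ + 1)) := by
  have hβ : 0 ≤ μ / 2 := by positivity
  obtain ⟨τ, hτ⟩ : ∃ τ, τ = (μ - ν + 2) / 2 := ⟨_, rfl⟩
  obtain ⟨σ, hs⟩ : ∃ σ, σ = (μ + ν + 2) / 2 := ⟨_, rfl⟩
  have hσ0 : 0 < σ := by rw [hs]; positivity
  have hστ : σ + τ = 2 * (μ / 2) + 2 := by rw [hs, hτ]; ring
  have hα : ν / 2 = σ - μ / 2 - 1 := by rw [hs]; ring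
  rw [← hτ] at h
  have h1 : ∀ x ∈ Ioi (0 : ℝ), Lambda₂ μ ν j x ^ 2 * x ^ (μ + ν + 1)
      = (∑ l ∈ Finset.range (j + 1), ∑ k ∈ Finset.range (j + 1),
        macdonaldCoeff (μ / 2) τ j k / Real.Gamma (μ / 2 + 1) *
          (macdonaldCoeff (μ / 2) τ j l / Real.Gamma (μ / 2 + 1)) *
        (macdonald (k - (σ - μ / 2 - 1)) (x ^ 2 / 4) *
          macdonald (l - (σ - μ / 2 - 1)) (x ^ 2 / 4) * x ^ (2 * σ - 1))) * 4⁻¹ := by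
    intro x hx
    rw [Lambda₂_eq_sum hμ ν j hx, ← hτ, hα, show μ + ν + 1 = 2 * σ - 1 by rw [hs]; ring, div_pow,
      sq, Finset.sum_mul_sum, Finset.sum_comm, div_mul_eq_mul_div, Finset.sum_mul, div_eq_mul_inv]
    norm_num
    refine Finset.sum_congr rfl fun l _ => ?_
    rw [Finset.sum_mul]
    refine Finset.sum_congr rfl fun k _ => ?_
    ring
  have h2 : ∀ k ∈ Finset.range (j + 1), ∀ l ∈ Finset.range (j + 1), _ := fun k hk l hl =>
    integrableOn_and_integral_macdonaldCoeff_mul hβ hσ0 hστ h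
      (Nat.lt_succ_iff.1 (Finset.mem_range.1 hk)) (Nat.lt_succ_iff.1 (Finset.mem_range.1 hl))
      (Real.Gamma (μ / 2 + 1))
  have h3 : ∀ l ∈ Finset.range (j + 1), _ := fun l hl =>
    integral_finsetSum (Finset.range (j + 1)) fun k hk => (h2 k hk l hl).1
  rw [setIntegral_congr_fun measurableSet_Ioi h1, integral_mul_const,
    integral_finsetSum _ fun l hl => integrable_finsetSum _ fun k hk => (h2 k hk l hl).1,
    Finset.sum_congr rfl h3,
    Finset.sum_congr rfl fun l hl => Finset.sum_congr rfl fun k hk => (h2 k hk l hl).2]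
  simp only [← Finset.mul_sum]
  rw [sum_sum_macdonaldCoeff hβ h, ← hs, ← hτ, ← hστ, add_sub_cancel_right, add_comm (j : ℝ) σ,
    add_comm (j : ℝ) τ, Gamma_add_natCast hσ0, show 2 * σ - 1 = μ + ν - 1 + 2 by rw [hs]; ring,
    Real.rpow_add two_pos, mul_div_cancel₀ _ two_ne_zero]
  norm_num
  ring

lemma macdonald_le_macdonald {q q' : ℝ} (hq : 0 < q) (h : q ≤ q') (c : ℝ) :
    macdonald c q' ≤ macdonald c q := by
  refine setIntegral_mono_on (integrableOn_rpow_mul_exp_neg (hq.trans_le h) (c - 1))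
    (integrableOn_rpow_mul_exp_neg hq (c - 1)) measurableSet_Ioi fun w (hw : 0 < w) => ?_
  gcongr

lemma macdonald_le_Gamma {q c : ℝ} (hq : 0 < q) (hc : 0 < c) :
    macdonald c q ≤ Real.Gamma c := by
  rw [Real.Gamma_eq_integral hc]
  refine setIntegral_mono_on (integrableOn_rpow_mul_exp_neg hq (c - 1))
    (Real.GammaIntegral_convergent hc) measurableSet_Ioi fun w (hw : 0 < w) => ?_
  rw [mul_comm]
  gcongr
  have : 0 ≤ q / w := by positivity
  linarith

lemma macdonald_neg (c : ℝ) {x : ℝ} (hx : 0 < x) :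
    macdonald (-c) (x ^ 2 / 4) = (x / 2) ^ (-(2 * c)) * macdonald c (x ^ 2 / 4) := by
  have h1 := tildeK_eq_macdonald c hx
  have h2 := tildeK_eq_macdonald (-c) hx
  have h3 : besselK (-c) x = besselK c x := by simp [besselK]
  rw [tildeK, h3] at h2
  rw [tildeK] at h1
  rw [neg_neg] at h2
  have h4 : (x / 2) ^ (-(2 * c)) * (x / 2) ^ c = (x / 2) ^ (-c) := by
    rw [← Real.rpow_add (by positivity)]
    ring_nf
  linear_combination (-2) * h1 + 2 * (x / 2) ^ (-(2 * c)) * h2 - 2 * besselK c x * h4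

lemma tendsto_pow_mul_macdonald {k : ℕ} (hk : k ≠ 0) {c : ℝ} (hc : 0 < c) :
    Tendsto (fun x : ℝ => (x / 2) ^ (2 * k) * macdonald c (x ^ 2 / 4)) (𝓝[>] 0) (𝓝 0) := by
  have h : Tendsto (fun x : ℝ => (x / 2) ^ (2 * k) * Real.Gamma c) (𝓝[>] 0) (𝓝 0) := by
    refine Tendsto.mono_left ?_ nhdsWithin_le_nhds
    have : Continuous fun x : ℝ => (x / 2) ^ (2 * k) * Real.Gamma c := by fun_prop
    simpa [hk] using this.tendsto 0
  refine tendsto_of_tendsto_of_tendsto_of_le_of_le' tendsto_const_nhds h ?_ ?_ <;>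
    filter_upwards [self_mem_nhdsWithin] with x (hx : 0 < x)
  · exact mul_nonneg (by positivity) (macdonald_pos (by positivity) c).le
  · exact mul_le_mul_of_nonneg_left (macdonald_le_Gamma (by positivity) hc) (by positivity)

lemma exists_eventually_le_rpow_mul_abs_Lambda₂ {μ ν : ℝ} (hμ : 0 ≤ μ) {j : ℕ}
    (h : j + (μ - ν + 2) / 2 ≤ 0) :
    ∃ c > 0, ∀ᶠ x in 𝓝[>] (0 : ℝ), c ≤ (x / 2) ^ ν * |Lambda₂ μ ν j x| := by
  have hG := Real.Gamma_pos_of_pos (show 0 < μ / 2 + 1 by positivity)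
  obtain ⟨e, he⟩ : ∃ e : ℕ → ℝ, ∀ k, e k =
      macdonaldCoeff (μ / 2) ((μ - ν + 2) / 2) j k / Real.Gamma (μ / 2 + 1) := ⟨_, fun _ => rfl⟩
  have he0 : e 0 ≠ 0 := by
    rw [he, macdonaldCoeff_zero_right]
    refine div_ne_zero (div_ne_zero ?_ (by exact_mod_cast j.factorial_ne_zero)) hG.ne'
    rw [rising, Ne, ascPochhammer_eval_eq_zero_iff]
    rintro ⟨k, hk, hk'⟩
    have : (k : ℝ) < j := by exact_mod_cast hk
    linarith
  have hsum : ∀ x : ℝ, 0 < x → (x / 2) ^ ν * Lambda₂ μ ν j x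
      = (∑ k ∈ Finset.range j, e (k + 1) *
          ((x / 2) ^ (2 * (k + 1)) * macdonald (ν / 2 - (k + 1 : ℕ)) (x ^ 2 / 4))
        + e 0 * macdonald (ν / 2) (x ^ 2 / 4)) / 2 := by
    intro x hx
    have hx2 : 0 < x / 2 := by positivity
    simp only [Lambda₂_eq_sum hμ ν j hx, ← he]
    rw [← mul_div_assoc, Finset.mul_sum, Finset.sum_range_succ']
    congr 2
    · refine Finset.sum_congr rfl fun k _ => ?_
      rw [← neg_sub (ν / 2), macdonald_neg _ hx, ← Real.rpow_natCast (x / 2) (2 * (k + 1)),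
        show (((2 * (k + 1) : ℕ)) : ℝ) = ν + -(2 * (ν / 2 - (k + 1 : ℕ))) by push_cast; ring,
        Real.rpow_add hx2]
      ring
    · rw [Nat.cast_zero, zero_sub, macdonald_neg _ hx, mul_div_cancel₀ _ two_ne_zero,
        Real.rpow_neg hx2.le]
      have := (Real.rpow_pos_of_pos hx2 ν).ne'
      field_simp
  have hlim : Tendsto (fun x : ℝ => ∑ k ∈ Finset.range j, e (k + 1) *
      ((x / 2) ^ (2 * (k + 1)) * macdonald (ν / 2 - (k + 1 : ℕ)) (x ^ 2 / 4))) (𝓝[>] 0) (𝓝 0) := by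
    have h0 : ∑ _k ∈ Finset.range j, (0 : ℝ) = 0 := Finset.sum_const_zero
    rw [← h0]
    refine tendsto_finsetSum _ fun k hk => ?_
    have hk : ((k + 1 : ℕ) : ℝ) ≤ j := by exact_mod_cast Finset.mem_range.1 hk
    simpa using (tendsto_pow_mul_macdonald k.succ_ne_zero (c := ν / 2 - (k + 1 : ℕ))
      (by linarith)).const_mul (e (k + 1))
  have hm := macdonald_pos one_pos (ν / 2)
  have hc : 0 < |e 0| * macdonald (ν / 2) 1 := mul_pos (abs_pos.2 he0) hm
  refine ⟨|e 0| * macdonald (ν / 2) 1 / 4, by positivity, ?_⟩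
  filter_upwards [self_mem_nhdsWithin, hlim.eventually (Metric.ball_mem_nhds 0 (half_pos hc)),
    Ioo_mem_nhdsGT (zero_lt_one (α := ℝ))] with x (hx : 0 < x) hx1 hx2
  rw [Real.dist_eq, sub_zero] at hx1
  rw [← abs_of_pos (Real.rpow_pos_of_pos (half_pos hx) ν), ← abs_mul, hsum x hx, abs_div, abs_two]
  have h1 : |e 0| * macdonald (ν / 2) 1 ≤ |e 0 * macdonald (ν / 2) (x ^ 2 / 4)| := by
    rw [abs_mul, abs_of_pos (macdonald_pos (by positivity) _)]
    refine mul_le_mul_of_nonneg_left (macdonald_le_macdonald (by positivity) ?_ _) (abs_nonneg _)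
    nlinarith [hx2.1, hx2.2]
  have h2 := abs_sub_abs_le_abs_add (e 0 * macdonald (ν / 2) (x ^ 2 / 4))
    (∑ k ∈ Finset.range j, e (k + 1) *
      ((x / 2) ^ (2 * (k + 1)) * macdonald (ν / 2 - (k + 1 : ℕ)) (x ^ 2 / 4)))
  rw [add_comm (e 0 * _)] at h2
  linarith

lemma not_integrableOn_Lambda₂_sq {μ ν : ℝ} (hμ : 0 ≤ μ) {j : ℕ}
    (h : j + (μ - ν + 2) / 2 ≤ 0) :
    ¬ IntegrableOn (fun x => Lambda₂ μ ν j x ^ 2 * x ^ (μ + ν + 1)) (Ioi (0 : ℝ)) := by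
  intro hint
  obtain ⟨c, hc, hev⟩ := exists_eventually_le_rpow_mul_abs_Lambda₂ hμ h
  obtain ⟨ε, hε, hsub⟩ := mem_nhdsGT_iff_exists_Ioo_subset.1 hev
  have hε : 0 < ε := hε
  have hpow : ¬ IntegrableOn (fun x : ℝ => x ^ (μ - ν + 1)) (Ioo 0 ε) := by
    rw [intervalIntegral.integrableOn_Ioo_rpow_iff hε, not_lt]
    have : (0 : ℝ) ≤ j := by positivity
    linarith
  refine hpow ?_
  have hint' := (hint.mono_set (fun x (hx : x ∈ Ioo 0 ε) => hx.1)).const_mul ((c ^ 2 * 4 ^ ν)⁻¹)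
  refine Integrable.mono' hint' ?_ ?_
  · exact ContinuousOn.aestronglyMeasurable (fun x hx =>
      (Real.continuousAt_rpow_const _ _ (Or.inl hx.1.ne')).continuousWithinAt) measurableSet_Ioo
  · rw [ae_restrict_iff' measurableSet_Ioo]
    refine Eventually.of_forall fun x hx => ?_
    have hx0 : 0 < x := hx.1
    have hle : c ^ 2 ≤ ((x / 2) ^ ν * |Lambda₂ μ ν j x|) ^ 2 := by
      have : c ≤ (x / 2) ^ ν * |Lambda₂ μ ν j x| := hsub hx
      gcongr
    rw [mul_pow, sq_abs] at hle
    have h4 : (0 : ℝ) < 4 ^ ν := by positivity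
    have h5 : ((x / 2) ^ ν) ^ 2 * 4 ^ ν = x ^ ν * x ^ ν := by
      rw [sq, ← Real.mul_rpow (by positivity) (by positivity),
        ← Real.mul_rpow (by positivity) (by positivity),
        ← Real.mul_rpow (by positivity) (by positivity)]
      ring_nf
    have h6 : x ^ (μ + ν + 1) = x ^ (μ - ν + 1) * (x ^ ν * x ^ ν) := by
      rw [← Real.rpow_add hx0, ← Real.rpow_add hx0]
      ring_nf
    rw [Real.norm_of_nonneg (by positivity), inv_mul_eq_div, le_div_iff₀ (by positivity), h6, ← h5]
    have h7 : 0 < x ^ (μ - ν + 1) := by positivity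
    calc x ^ (μ - ν + 1) * (c ^ 2 * 4 ^ ν)
        ≤ x ^ (μ - ν + 1) * (((x / 2) ^ ν) ^ 2 * Lambda₂ μ ν j x ^ 2 * 4 ^ ν) := by gcongr
      _ = _ := by ring

lemma nonvanishingIndicesPos_of_pos {τ : ℝ} (h : 0 < τ) (j : ℕ) : NonvanishingIndicesPos τ j :=
  fun _ _ => Or.inr (by positivity)

lemma nonvanishingIndicesPos_intCast {n : ℤ} {j : ℕ} (h : 0 < n + j) :
    NonvanishingIndicesPos n j := by
  intro k hk
  rcases lt_or_ge 0 (n + k) with hpos | hneg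
  · exact Or.inr (by exact_mod_cast hpos)
  · refine Or.inl ((ascPochhammer_eval_eq_zero_iff _ _).2 ⟨(-(n + k)).toNat, by omega, ?_⟩)
    rw [← Int.cast_natCast, Int.toNat_of_nonneg (by omega)]
    push_cast
    ring

/-- For `(μ,ν) ∈ Ξ`, the squared `L²`-norm of `Λ_{2,j}^{μ,ν}`:
`∫₀^∞ |Λ_{2,j}^{μ,ν}(x)|²·x^{μ+ν+1} dx
  = 2^{μ+ν−1}·Γ(j+(μ+ν+2)/2)·Γ(j+(μ−ν+2)/2)/(j!·(2j+μ+1)·Γ(j+μ+1))`. -/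
theorem statement17 (μ ν : ℝ) (h : XiCond μ ν) (j : ℕ) :
    ∫ x in Ioi (0 : ℝ), Lambda₂ μ ν j x ^ 2 * x ^ (μ + ν + 1)
      = 2 ^ (μ + ν - 1) * Real.Gamma ((j : ℝ) + (μ + ν + 2) / 2) *
          Real.Gamma ((j : ℝ) + (μ - ν + 2) / 2) /
        ((j.factorial : ℝ) * (2 * (j : ℝ) + μ + 1) * Real.Gamma ((j : ℝ) + μ + 1)) := by
  rcases h with ⟨rfl, k, hk⟩ | ⟨rfl, k, rfl⟩ | ⟨a, b, rfl, rfl, c, hc⟩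
  · have hμ : 0 ≤ μ := by
      have : (0 : ℝ) ≤ k := k.cast_nonneg
      linarith
    exact integral_Lambda₂_sq hμ (by linarith)
      (nonvanishingIndicesPos_of_pos (by linarith) j)
  · exact integral_Lambda₂_sq k.cast_nonneg (by positivity)
      (nonvanishingIndicesPos_of_pos (by rw [sub_zero]; positivity) j)
  · have hτ : ((a : ℝ) - b + 2) / 2 = ((c - b + 1 : ℤ) : ℝ) := by
      have : (a : ℝ) + b = c + c := by exact_mod_cast hc
      push_cast
      linarith
    rcases lt_or_ge 0 ((c - b + 1 : ℤ) + (j : ℤ)) with hpos | hneg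
    · exact integral_Lambda₂_sq a.cast_nonneg (by positivity)
        (hτ ▸ nonvanishingIndicesPos_intCast hpos)
    · have hle : (j : ℝ) + ((a : ℝ) - b + 2) / 2 ≤ 0 := by
        rw [hτ, add_comm]
        exact_mod_cast hneg
      have hΓ : Real.Gamma ((j : ℝ) + ((a : ℝ) - b + 2) / 2) = 0 := by
        rw [hτ, Real.Gamma_eq_zero_iff]
        refine ⟨(-((c - b + 1 : ℤ) + (j : ℤ))).toNat, ?_⟩
        rw [← Int.cast_natCast (R := ℝ) (Int.toNat _), Int.toNat_of_nonneg (by omega)]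
        push_cast
        ring
      rw [integral_undef (not_integrableOn_Lambda₂_sq a.cast_nonneg hle), hΓ, mul_zero, zero_div]
end
end

section
/- Fix real μ, ν, let i ∈ {1,2}, j ∈ ℤ and x > 0, and set ε(1) = +1, ε(2) = −1. Then the following three recurrence relations hold: (1) μ·(Λ_{i,j}^{μ,ν}(x) − Λ_{i,j−1}^{μ,ν}(x)) = 2·(Λ_{i,j}^{μ−2,ν}(x) − (x/2)²·Λ_{i,j−2}^{μ+2,ν}(x)); (2) ν·(Λ_{i,j}^{μ,ν}(x) − Λ_{i,j−1}^{μ,ν}(x)) = 2·ε(i)·(Λ_{i,j}^{μ,ν−2}(x) − (x/2)²·Λ_{i,j}^{μ,ν+2}(x)); (3) (d/dx)(Λ_{i,j}^{μ,ν}(x) − Λ_{i,j−1}^{μ,ν}(x)) = (x/2)·Λ_{i,j−2}^{μ+2,ν}(x) + ε(i)·(x/2)·Λ_{i,j}^{μ,ν+2}(x). -/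
noncomputable section

open Set MeasureTheory Filter Topology

/-- The coefficient `1 / (n! Γ(n + α + 1))` of the normalized I-Bessel series. -/
def besselCoeff (α : ℝ) (n : ℕ) : ℝ :=
  ((n.factorial : ℝ) * Real.Gamma ((n : ℝ) + α + 1))⁻¹

theorem Real.inv_Gamma_eq_self_mul_inv_Gamma_add_one (s : ℝ) :
    (Real.Gamma s)⁻¹ = s * (Real.Gamma (s + 1))⁻¹ := by
  rcases eq_or_ne s 0 with rfl | hs
  · simp [Real.Gamma_zero]
  · rw [Real.Gamma_add_one hs, mul_inv, mul_inv_cancel_left₀ hs]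

theorem besselCoeff_succ (α : ℝ) (n : ℕ) :
    ((n : ℝ) + 1) * besselCoeff α (n + 1) = besselCoeff (α + 1) n := by
  have h : (n : ℝ) + 1 ≠ 0 := by positivity
  have e : ((n + 1 : ℕ) : ℝ) + α + 1 = n + (α + 1) + 1 := by push_cast; ring
  unfold besselCoeff
  rw [e, Nat.factorial_succ]
  push_cast
  rw [mul_assoc, mul_inv, mul_inv_cancel_left₀ h]

theorem besselCoeff_sub_one (α : ℝ) (n : ℕ) :
    besselCoeff (α - 1) n = ((n : ℝ) + α) * besselCoeff α n := by
  unfold besselCoeff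
  rw [show (n : ℝ) + (α - 1) + 1 = n + α by ring, mul_inv, mul_inv,
    Real.inv_Gamma_eq_self_mul_inv_Gamma_add_one ((n : ℝ) + α)]
  ring

theorem besselCoeff_eq (α : ℝ) (n : ℕ) :
    besselCoeff α n = ((n : ℝ) + α + 1) * (((n : ℝ) + 1) * besselCoeff α (n + 1)) := by
  have h := besselCoeff_sub_one (α + 1) n
  rw [add_sub_cancel_right] at h
  rw [besselCoeff_succ, h]
  ring

theorem summable_besselCoeff (α r : ℝ) :
    Summable fun n : ℕ => ((n : ℝ) + 1) * (besselCoeff α n * r ^ n) := by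
  refine summable_of_ratio_norm_eventually_le (r := 1 / 2) (by norm_num) ?_
  obtain ⟨N, hN⟩ := exists_nat_ge (max |α| (4 * |r|))
  filter_upwards [eventually_ge_atTop N] with n hn
  have hnN : (N : ℝ) ≤ n := by exact_mod_cast hn
  have h1 : |α| ≤ n := (le_max_left _ _).trans (hN.trans hnN)
  have h2 : 4 * |r| ≤ n := (le_max_right _ _).trans (hN.trans hnN)
  have h3 : 1 ≤ |(n : ℝ) + α + 1| := by
    have := neg_abs_le α
    exact (by linarith : (1 : ℝ) ≤ (n : ℝ) + α + 1).trans (le_abs_self _)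
  have hn0 : (0 : ℝ) ≤ n := n.cast_nonneg
  have h4 : ((n : ℝ) + 1) * |besselCoeff α (n + 1)| ≤ |besselCoeff α n| := by
    rw [besselCoeff_eq α n, abs_mul, abs_mul, abs_of_nonneg (by positivity : (0 : ℝ) ≤ n + 1)]
    exact le_mul_of_one_le_left (by positivity) h3
  simp only [Real.norm_eq_abs, abs_mul, abs_pow, Nat.cast_add, Nat.cast_one]
  rw [abs_of_nonneg (by positivity : (0 : ℝ) ≤ n + 1),
    abs_of_nonneg (by positivity : (0 : ℝ) ≤ n + 1 + 1)]
  have h5 : ((n : ℝ) + 1 + 1) * |r| ≤ 1 / 2 * ((n + 1) * (n + 1)) := by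
    nlinarith [abs_nonneg r]
  have hc : 0 ≤ |besselCoeff α (n + 1)| * |r| ^ n := by positivity
  have hr : 0 ≤ ((n : ℝ) + 1) * |r| ^ n := by positivity
  calc ((n : ℝ) + 1 + 1) * (|besselCoeff α (n + 1)| * |r| ^ (n + 1))
      = (((n : ℝ) + 1 + 1) * |r|) * (|besselCoeff α (n + 1)| * |r| ^ n) := by ring
    _ ≤ (1 / 2 * ((n + 1) * (n + 1))) * (|besselCoeff α (n + 1)| * |r| ^ n) :=
        mul_le_mul_of_nonneg_right h5 hc
    _ = 1 / 2 * ((((n : ℝ) + 1) * |r| ^ n) * (((n : ℝ) + 1) * |besselCoeff α (n + 1)|)) := by ring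
    _ ≤ 1 / 2 * ((((n : ℝ) + 1) * |r| ^ n) * |besselCoeff α n|) := by gcongr
    _ = 1 / 2 * (((n : ℝ) + 1) * (|besselCoeff α n| * |r| ^ n)) := by ring

theorem summable_besselCoeff_mul_pow (α r : ℝ) :
    Summable fun n : ℕ => besselCoeff α n * r ^ n := by
  refine Summable.of_norm_bounded (summable_besselCoeff α r).norm fun n => ?_
  rw [norm_mul ((n : ℝ) + 1)]
  refine le_mul_of_one_le_left (norm_nonneg _) ?_
  rw [Real.norm_eq_abs, abs_of_nonneg (by positivity)]
  linarith [(n.cast_nonneg : (0 : ℝ) ≤ n)]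

/-- The entire function `w ↦ Σ wⁿ / (n! Γ(n + α + 1))`. -/
def besselSeries (α w : ℝ) : ℝ := ∑' n : ℕ, besselCoeff α n * w ^ n

theorem hasSum_besselSeries_deriv (α w : ℝ) :
    HasSum (fun n : ℕ => besselCoeff α n * ((n : ℝ) * w ^ (n - 1))) (besselSeries (α + 1) w) := by
  rw [← hasSum_nat_add_iff' 1]
  simp only [Finset.range_one, Finset.sum_singleton, Nat.cast_zero, zero_mul, mul_zero, sub_zero]
  refine (summable_besselCoeff_mul_pow (α + 1) w).hasSum.congr_fun fun n => ?_
  rw [← besselCoeff_succ]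
  push_cast [Nat.add_sub_cancel]
  ring

theorem hasDerivAt_besselSeries (α w : ℝ) :
    HasDerivAt (besselSeries α) (besselSeries (α + 1) w) w := by
  rw [← (hasSum_besselSeries_deriv α w).tsum_eq]
  have hR : 1 ≤ |w| + 1 := by linarith [abs_nonneg w]
  refine hasDerivAt_tsum_of_isPreconnected (t := Metric.ball 0 (|w| + 1)) (y₀ := 0)
    (g := fun (n : ℕ) w => besselCoeff α n * w ^ n)
    (g' := fun (n : ℕ) w => besselCoeff α n * ((n : ℝ) * w ^ (n - 1)))
    (summable_besselCoeff α (|w| + 1)).norm Metric.isOpen_ball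
    (convex_ball 0 _).isPreconnected (fun n y _ => (hasDerivAt_pow n y).const_mul _) ?_ ?_
    (summable_besselCoeff_mul_pow α 0) ?_
  · intro n y hy
    have hy' : |y| ≤ |w| + 1 := by simpa using (Metric.mem_ball.1 hy).le
    simp only [Real.norm_eq_abs, abs_mul, abs_pow, Nat.abs_cast]
    rw [abs_of_nonneg (by positivity : (0 : ℝ) ≤ n + 1),
      abs_of_nonneg (by positivity : (0 : ℝ) ≤ |w| + 1)]
    calc |besselCoeff α n| * ((n : ℝ) * |y| ^ (n - 1))
        ≤ |besselCoeff α n| * (((n : ℝ) + 1) * (|w| + 1) ^ n) := by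
          gcongr ?_ * (?_ * ?_)
          · linarith
          · exact (pow_le_pow_left₀ (abs_nonneg y) hy' _).trans
              (pow_le_pow_right₀ hR (Nat.sub_le n 1))
      _ = ((n : ℝ) + 1) * (|besselCoeff α n| * (|w| + 1) ^ n) := by ring
  · simpa using (by positivity : (0 : ℝ) < |w| + 1)
  · simp

theorem besselSeries_recurrence (α w : ℝ) :
    α * besselSeries α w = besselSeries (α - 1) w - w * besselSeries (α + 1) w := by
  have h1 := (summable_besselCoeff_mul_pow α w).hasSum.mul_left α
  have h2 := (hasSum_besselSeries_deriv α w).mul_left w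
  have h3 := (summable_besselCoeff_mul_pow (α - 1) w).hasSum
  rw [eq_sub_iff_add_eq]
  refine (h1.add h2).unique (h3.congr_fun fun n => ?_)
  rw [besselCoeff_sub_one]
  rcases n with _ | n
  · simp
  · rw [Nat.add_sub_cancel, pow_succ]
    ring

theorem tildeI_eq_besselSeries (α z : ℝ) : tildeI α z = besselSeries α ((z / 2) ^ 2) := by
  unfold tildeI besselSeries besselCoeff
  congr 1 with n
  rw [pow_mul, div_eq_mul_inv, mul_comm]

theorem hasDerivAt_tildeI (α z : ℝ) :
    HasDerivAt (tildeI α) (z / 2 * tildeI (α + 1) z) z := by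
  have h : HasDerivAt (fun z : ℝ => (z / 2) ^ 2) (z / 2) z := by
    refine (((hasDerivAt_id z).div_const 2).pow 2).congr_deriv ?_
    simp
    ring
  rw [show tildeI α = fun z => besselSeries α ((z / 2) ^ 2) from
    funext (tildeI_eq_besselSeries α), tildeI_eq_besselSeries, mul_comm]
  exact (hasDerivAt_besselSeries α ((z / 2) ^ 2)).comp z h

theorem tildeI_recurrence (α z : ℝ) :
    α * tildeI α z = tildeI (α - 1) z - (z / 2) ^ 2 * tildeI (α + 1) z := by
  simp only [tildeI_eq_besselSeries]
  exact besselSeries_recurrence α _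

theorem sq_div_four_le_cosh {s : ℝ} (hs : 0 ≤ s) : s ^ 2 / 4 ≤ Real.cosh s := by
  rw [Real.cosh_eq]
  have := Real.quadratic_le_exp_of_nonneg hs
  have := Real.exp_pos (-s)
  linarith

theorem integrableOn_exp_neg_mul_cosh_mul_exp {z : ℝ} (hz : 0 < z) (c : ℝ) :
    IntegrableOn (fun s => Real.exp (-z * Real.cosh s) * Real.exp (c * s)) (Ioi 0) := by
  have hg : Integrable (fun s : ℝ => Real.exp (2 * c ^ 2 / z) * Real.exp (-(z / 8) * s ^ 2)) :=
    (integrable_exp_neg_mul_sq (by positivity)).const_mul _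
  refine Integrable.mono' hg.integrableOn
    (Continuous.aestronglyMeasurable (by fun_prop)) ?_
  refine (ae_restrict_iff' measurableSet_Ioi).2 (ae_of_all _ fun s hs => ?_)
  rw [Real.norm_eq_abs, abs_of_pos (by positivity), ← Real.exp_add, ← Real.exp_add]
  refine Real.exp_le_exp.2 ?_
  have h1 : z * (s ^ 2 / 4) ≤ z * Real.cosh s :=
    mul_le_mul_of_nonneg_left (sq_div_four_le_cosh (le_of_lt hs)) hz.le
  have h2 : c * s ≤ 2 * c ^ 2 / z + z / 8 * s ^ 2 := by
    have : 0 ≤ 2 * c ^ 2 / z + z / 8 * s ^ 2 - c * s := by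
      have e : 2 * c ^ 2 / z + z / 8 * s ^ 2 - c * s = (4 * c - z * s) ^ 2 / (8 * z) := by
        field_simp
        ring
      rw [e]
      positivity
    linarith
  linarith

theorem integrableOn_besselK {z : ℝ} (hz : 0 < z) (α : ℝ) :
    IntegrableOn (fun s => Real.exp (-z * Real.cosh s) * Real.cosh (α * s)) (Ioi 0) := by
  refine (((integrableOn_exp_neg_mul_cosh_mul_exp hz α).add
    (integrableOn_exp_neg_mul_cosh_mul_exp hz (-α))).div_const 2).congr (ae_of_all _ fun s => ?_)
  simp only [Pi.add_apply]
  rw [Real.cosh_eq (α * s), neg_mul α s]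
  ring

theorem integrableOn_exp_neg_mul_cosh_mul_sinh {z : ℝ} (hz : 0 < z) (α : ℝ) :
    IntegrableOn (fun s => Real.exp (-z * Real.cosh s) * Real.sinh (α * s)) (Ioi 0) := by
  refine (((integrableOn_exp_neg_mul_cosh_mul_exp hz α).sub
    (integrableOn_exp_neg_mul_cosh_mul_exp hz (-α))).div_const 2).congr (ae_of_all _ fun s => ?_)
  simp only [Pi.sub_apply]
  rw [Real.sinh_eq (α * s), neg_mul α s]
  ring

theorem hasDerivAt_besselK {z : ℝ} (hz : 0 < z) (α : ℝ) :
    HasDerivAt (besselK α) (-(besselK (α - 1) z + besselK (α + 1) z) / 2) z := by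
  have key (w s : ℝ) : Real.exp (-w * Real.cosh s) * -Real.cosh s * Real.cosh (α * s) =
      -(Real.exp (-w * Real.cosh s) * Real.cosh ((α - 1) * s) +
        Real.exp (-w * Real.cosh s) * Real.cosh ((α + 1) * s)) / 2 := by
    rw [sub_mul, add_mul, one_mul, Real.cosh_add, Real.cosh_sub]
    ring
  have hint (w : ℝ) (hw : 0 < w) :
      IntegrableOn (fun s => Real.exp (-w * Real.cosh s) * -Real.cosh s * Real.cosh (α * s))
        (Ioi 0) := by
    simp only [key]
    exact ((integrableOn_besselK hw _).add (integrableOn_besselK hw _)).neg.div_const 2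
  have h := (hasDerivAt_integral_of_dominated_loc_of_deriv_le (μ := volume.restrict (Ioi 0))
    (F := fun w s => Real.exp (-w * Real.cosh s) * Real.cosh (α * s))
    (F' := fun w s => Real.exp (-w * Real.cosh s) * -Real.cosh s * Real.cosh (α * s))
    (bound := fun s =>
      ‖Real.exp (-(z / 2) * Real.cosh s) * -Real.cosh s * Real.cosh (α * s)‖)
    (Ioi_mem_nhds (half_lt_self hz))
    (Eventually.of_forall fun w => Continuous.aestronglyMeasurable (by fun_prop))
    (integrableOn_besselK hz α) (Continuous.aestronglyMeasurable (by fun_prop))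
    (ae_of_all _ fun s w hw => ?_) (hint (z / 2) (half_pos hz)).norm
    (ae_of_all _ fun s w _ => ?_)).2
  · refine h.congr_deriv ?_
    simp only [key]
    rw [integral_div, integral_neg,
      integral_add (integrableOn_besselK hz _) (integrableOn_besselK hz _)]
    rfl
  · have : Real.exp (-w * Real.cosh s) ≤ Real.exp (-(z / 2) * Real.cosh s) := by
      refine Real.exp_le_exp.2 (mul_le_mul_of_nonneg_right ?_ (Real.cosh_pos s).le)
      exact neg_le_neg (le_of_lt hw)
    simp only [norm_mul, Real.norm_eq_abs, Real.abs_exp]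
    gcongr
  · have h1 : HasDerivAt (fun w : ℝ => -w * Real.cosh s) (-Real.cosh s) w := by
      simpa using (hasDerivAt_id w).neg.mul_const (Real.cosh s)
    exact h1.exp.mul_const _

theorem besselK_recurrence {z : ℝ} (hz : 0 < z) (α : ℝ) :
    2 * α * besselK α z = z * (besselK (α + 1) z - besselK (α - 1) z) := by
  have hd (s : ℝ) : HasDerivAt (fun s => Real.exp (-z * Real.cosh s) * Real.sinh (α * s))
      (α * (Real.exp (-z * Real.cosh s) * Real.cosh (α * s)) -
        z / 2 * (Real.exp (-z * Real.cosh s) * Real.cosh ((α + 1) * s) -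
          Real.exp (-z * Real.cosh s) * Real.cosh ((α - 1) * s))) s := by
    have h1 := ((Real.hasDerivAt_cosh s).const_mul (-z)).exp
    have h2 := ((hasDerivAt_id s).const_mul α).sinh
    refine (h1.mul h2).congr_deriv ?_
    rw [sub_mul, add_mul, one_mul, Real.cosh_add, Real.cosh_sub]
    simp only [id]
    ring
  have i1 := integrableOn_besselK hz α
  have i2 := integrableOn_besselK hz (α + 1)
  have i3 := integrableOn_besselK hz (α - 1)
  have hi := (i1.const_mul α).sub ((i2.sub i3).const_mul (z / 2))
  have ht := tendsto_zero_of_hasDerivAt_of_integrableOn_Ioi (a := 0) (fun s _ => hd s) hi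
    (integrableOn_exp_neg_mul_cosh_mul_sinh hz α)
  have h := integral_Ioi_of_hasDerivAt_of_tendsto' (a := 0) (fun s _ => hd s) hi ht
  have i23 : IntegrableOn (fun s => z / 2 * (Real.exp (-z * Real.cosh s) * Real.cosh ((α + 1) * s) -
      Real.exp (-z * Real.cosh s) * Real.cosh ((α - 1) * s))) (Ioi 0) :=
    (i2.sub i3).const_mul (z / 2)
  rw [integral_sub (i1.const_mul α) i23, integral_const_mul, integral_const_mul,
    integral_sub i2 i3] at h
  simp only [mul_zero, Real.sinh_zero, sub_zero] at h
  unfold besselK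
  linarith

theorem tildeK_add_one {z : ℝ} (hz : 0 < z) (α : ℝ) :
    z / 2 * tildeK (α + 1) z = (z / 2) ^ (-α) * besselK (α + 1) z := by
  unfold tildeK
  rw [← mul_assoc, neg_add, ← sub_eq_add_neg, Real.rpow_sub_one (by positivity)]
  field_simp

theorem hasDerivAt_tildeK {z : ℝ} (hz : 0 < z) (α : ℝ) :
    HasDerivAt (tildeK α) (-(z / 2 * tildeK (α + 1) z)) z := by
  have hz2 : z / 2 ≠ 0 := by positivity
  have h1 : HasDerivAt (fun z : ℝ => (z / 2) ^ (-α)) _ z :=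
    ((hasDerivAt_id z).div_const 2).rpow_const (p := -α) (Or.inl hz2)
  refine (h1.mul (hasDerivAt_besselK hz α)).congr_deriv ?_
  have h := besselK_recurrence hz α
  rw [tildeK_add_one hz, id, Real.rpow_sub_one hz2]
  field_simp
  linear_combination -h

theorem tildeK_recurrence {z : ℝ} (hz : 0 < z) (α : ℝ) :
    α * tildeK α z = -(tildeK (α - 1) z - (z / 2) ^ 2 * tildeK (α + 1) z) := by
  have h := besselK_recurrence hz α
  have h1 : tildeK (α - 1) z = z / 2 * ((z / 2) ^ (-α) * besselK (α - 1) z) := by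
    unfold tildeK
    rw [neg_sub, sub_eq_neg_add, Real.rpow_add_one (by positivity)]
    ring
  rw [sq, mul_assoc, tildeK_add_one hz, h1]
  unfold tildeK
  linear_combination (z / 2) ^ (-α) / 2 * h

open scoped ContDiff

theorem contDiffOn_of_hasDerivAt_shift {s : Set ℝ} (hs : IsOpen s) {F : ℝ → ℝ → ℝ} {g : ℝ → ℝ}
    (hg : ContDiffOn ℝ ∞ g s)
    (hF : ∀ α, ∀ z ∈ s, HasDerivAt (F α) (g z * F (α + 1) z) z) (α : ℝ) :
    ContDiffOn ℝ ∞ (F α) s := by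
  rw [contDiffOn_infty]
  intro n
  induction n generalizing α with
  | zero =>
    exact contDiffOn_zero.2 fun z hz => (hF α z hz).continuousAt.continuousWithinAt
  | succ n ih =>
    push_cast
    rw [contDiffOn_succ_iff_deriv_of_isOpen hs]
    refine ⟨fun z hz => (hF α z hz).differentiableAt.differentiableWithinAt, by simp, ?_⟩
    exact ((contDiffOn_infty.1 hg n).mul (ih (α + 1))).congr fun z hz => (hF α z hz).deriv

theorem contDiff_tildeI (α : ℝ) : ContDiff ℝ ∞ (tildeI α) :=
  contDiffOn_univ.1 <| contDiffOn_of_hasDerivAt_shift isOpen_univ (g := fun z => z / 2)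
    (by fun_prop) (fun α z _ => hasDerivAt_tildeI α z) α

section MixedPartials

variable {U : Set (ℝ × ℝ)} {f : ℝ × ℝ → ℝ}

theorem ContDiffOn.fderiv_apply_const (hU : IsOpen U) (hf : ContDiffOn ℝ ∞ f U) (v : ℝ × ℝ) :
    ContDiffOn ℝ ∞ (fun q => fderiv ℝ f q v) U :=
  (hf.fderiv_of_isOpen hU (m := ∞) le_rfl).clm_apply contDiffOn_const

theorem fderiv_fderiv_apply_comm (hU : IsOpen U) (hf : ContDiffOn ℝ ∞ f U) {q : ℝ × ℝ}
    (hq : q ∈ U) (v w : ℝ × ℝ) :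
    fderiv ℝ (fun p => fderiv ℝ f p v) q w = fderiv ℝ (fun p => fderiv ℝ f p w) q v := by
  have hd : DifferentiableAt ℝ (fderiv ℝ f) q :=
    ((hf.fderiv_of_isOpen hU (m := ∞) le_rfl).contDiffAt (hU.mem_nhds hq)).differentiableAt
      (by simp)
  have e (v w : ℝ × ℝ) :
      fderiv ℝ (fun p => fderiv ℝ f p v) q w = fderiv ℝ (fderiv ℝ f) q w v := by
    rw [fderiv_clm_apply hd (differentiableAt_const v)]
    simp
  rw [e, e]
  refine (hf.contDiffAt (hU.mem_nhds hq)).isSymmSndFDerivAt ?_ w v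
  simp only [minSmoothness_of_isRCLikeNormedField]
  exact WithTop.coe_le_coe.2 le_top

theorem hasDerivAt_fst (hU : IsOpen U) (hf : ContDiffOn ℝ ∞ f U) {t y : ℝ} (h : (t, y) ∈ U) :
    HasDerivAt (fun s => f (s, y)) (fderiv ℝ f (t, y) (1, 0)) t := by
  have hd : HasFDerivAt f (fderiv ℝ f (t, y)) (t, y) :=
    ((hf.contDiffAt (hU.mem_nhds h)).differentiableAt (by simp)).hasFDerivAt
  exact hd.comp_hasDerivAt t ((hasDerivAt_id t).prodMk (hasDerivAt_const t y))

theorem hasDerivAt_snd (hU : IsOpen U) (hf : ContDiffOn ℝ ∞ f U) {t y : ℝ} (h : (t, y) ∈ U) :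
    HasDerivAt (fun z => f (t, z)) (fderiv ℝ f (t, y) (0, 1)) y := by
  have hd : HasFDerivAt f (fderiv ℝ f (t, y)) (t, y) :=
    ((hf.contDiffAt (hU.mem_nhds h)).differentiableAt (by simp)).hasFDerivAt
  exact hd.comp_hasDerivAt y ((hasDerivAt_const y t).prodMk (hasDerivAt_id y))

theorem iteratedDeriv_succ_fst (hU : IsOpen U) (hf : ContDiffOn ℝ ∞ f U) (n : ℕ) {t y : ℝ}
    (h : (t, y) ∈ U) :
    iteratedDeriv (n + 1) (fun s => f (s, y)) t =
      iteratedDeriv n (fun s => fderiv ℝ f (s, y) (1, 0)) t := by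
  rw [iteratedDeriv_succ']
  refine Filter.EventuallyEq.iteratedDeriv_eq n ?_
  have : ∀ᶠ s in 𝓝 t, (s, y) ∈ U :=
    (Continuous.prodMk_left y).continuousAt.eventually (hU.mem_nhds h)
  filter_upwards [this] with s hs using (hasDerivAt_fst hU hf hs).deriv

theorem hasDerivAt_iteratedDeriv_fst (hU : IsOpen U) (hf : ContDiffOn ℝ ∞ f U) (n : ℕ) {t y : ℝ}
    (h : (t, y) ∈ U) :
    HasDerivAt (fun z => iteratedDeriv n (fun s => f (s, z)) t)
      (iteratedDeriv n (fun s => fderiv ℝ f (s, y) (0, 1)) t) y := by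
  induction n generalizing f with
  | zero => simpa using hasDerivAt_snd hU hf h
  | succ n ih =>
    have hy : ∀ᶠ z in 𝓝 y, (t, z) ∈ U :=
      (Continuous.prodMk_right t).continuousAt.eventually (hU.mem_nhds h)
    have ht : ∀ᶠ s in 𝓝 t, (s, y) ∈ U :=
      (Continuous.prodMk_left y).continuousAt.eventually (hU.mem_nhds h)
    have key := ih (hf.fderiv_apply_const hU (1, 0))
    rw [iteratedDeriv_succ_fst hU (hf.fderiv_apply_const hU (0, 1)) n h]
    refine (key.congr_of_eventuallyEq ?_).congr_deriv ?_
    · filter_upwards [hy] with z hz using iteratedDeriv_succ_fst hU hf n hz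
    · refine Filter.EventuallyEq.iteratedDeriv_eq n ?_
      filter_upwards [ht] with s hs using fderiv_fderiv_apply_comm hU hf hs (1, 0) (0, 1)

end MixedPartials

/-- The `j`-th Taylor coefficient of `f` at `0`, with value `0` for `j < 0`. -/
def taylorCoeffZ (f : ℝ → ℝ) (j : ℤ) : ℝ :=
  if 0 ≤ j then iteratedDeriv j.toNat f 0 / (j.toNat.factorial : ℝ) else 0

section TaylorCoeff

variable {f g : ℝ → ℝ}

theorem taylorCoeffZ_natCast (f : ℝ → ℝ) (n : ℕ) :
    taylorCoeffZ f n = iteratedDeriv n f 0 / (n.factorial : ℝ) := by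
  simp [taylorCoeffZ]

theorem taylorCoeffZ_of_neg (f : ℝ → ℝ) {j : ℤ} (hj : j < 0) : taylorCoeffZ f j = 0 :=
  if_neg hj.not_ge

theorem taylorCoeffZ_congr (h : f =ᶠ[𝓝 0] g) (j : ℤ) : taylorCoeffZ f j = taylorCoeffZ g j := by
  unfold taylorCoeffZ
  rw [h.iteratedDeriv_eq]

theorem taylorCoeffZ_add (hf : ContDiffAt ℝ ∞ f 0) (hg : ContDiffAt ℝ ∞ g 0) (j : ℤ) :
    taylorCoeffZ (fun t => f t + g t) j = taylorCoeffZ f j + taylorCoeffZ g j := by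
  unfold taylorCoeffZ
  split_ifs
  · rw [iteratedDeriv_fun_add (contDiffAt_infty.1 hf _) (contDiffAt_infty.1 hg _), add_div]
  · simp

theorem taylorCoeffZ_const_mul (c : ℝ) (f : ℝ → ℝ) (j : ℤ) :
    taylorCoeffZ (fun t => c * f t) j = c * taylorCoeffZ f j := by
  unfold taylorCoeffZ
  split_ifs
  · rw [iteratedDeriv_const_mul_field, mul_div_assoc]
  · simp

theorem taylorCoeffZ_sub (hf : ContDiffAt ℝ ∞ f 0) (hg : ContDiffAt ℝ ∞ g 0) (j : ℤ) :
    taylorCoeffZ (fun t => f t - g t) j = taylorCoeffZ f j - taylorCoeffZ g j := by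
  unfold taylorCoeffZ
  split_ifs
  · rw [iteratedDeriv_fun_sub (contDiffAt_infty.1 hf _) (contDiffAt_infty.1 hg _), sub_div]
  · simp

theorem ContDiffAt.id_mul {t : ℝ} (hf : ContDiffAt ℝ ∞ f t) :
    ContDiffAt ℝ ∞ (fun t => t * f t) t :=
  contDiffAt_id.mul hf

theorem iteratedDeriv_succ_id_mul_zero (hf : ContDiffAt ℝ ∞ f 0) (n : ℕ) :
    iteratedDeriv (n + 1) (fun t => t * f t) 0 = ((n : ℝ) + 1) * iteratedDeriv n f 0 := by
  rw [iteratedDeriv_fun_mul (f := fun t => t) contDiffAt_id (contDiffAt_infty.1 hf _),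
    Finset.sum_eq_single 1]
  · have h : iteratedDeriv 1 (fun t : ℝ => t) 0 = 1 := by simp
    rw [h]
    simp
  · intro i _ hi
    have h : iteratedDeriv i (fun t : ℝ => t) 0 = 0 := by
      have := iteratedDeriv_id (𝕜 := ℝ) (n := i) (x := 0)
      rw [show (fun t : ℝ => t) = id from rfl, this]
      simp [hi]
    simp [h]
  · intro h
    simp at h

theorem taylorCoeffZ_id_mul (hf : ContDiffAt ℝ ∞ f 0) (j : ℤ) :
    taylorCoeffZ (fun t => t * f t) j = taylorCoeffZ f (j - 1) := by
  rcases lt_or_ge j 0 with hj | hj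
  · rw [taylorCoeffZ_of_neg _ hj, taylorCoeffZ_of_neg _ (by lia)]
  lift j to ℕ using hj
  rcases j with _ | n
  · rw [taylorCoeffZ_natCast, taylorCoeffZ_of_neg _ (by simp)]
    simp
  · rw [show ((n + 1 : ℕ) : ℤ) - 1 = (n : ℤ) by push_cast; ring, taylorCoeffZ_natCast,
      taylorCoeffZ_natCast, iteratedDeriv_succ_id_mul_zero hf, Nat.factorial_succ]
    push_cast
    rw [mul_div_mul_left _ _ (by positivity)]

end TaylorCoeff

/-- The generating function `(1 - t)^(-(μ+ν+2)/2) Ĩ_{μ/2}(tx/(1-t)) B_{ν/2}(x/(1-t))` attached to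
a family `B` of functions. -/
def genFun (B : ℝ → ℝ → ℝ) (μ ν t x : ℝ) : ℝ :=
  (1 - t) ^ (-(μ + ν + 2) / 2) * tildeI (μ / 2) (t * x / (1 - t)) * B (ν / 2) (x / (1 - t))

theorem one_sub_rpow_of_eq_sub_two {t : ℝ} (ht : t < 1) {a b : ℝ} (h : b = a - 2) :
    (1 - t) ^ (-(b + 2) / 2) = (1 - t) ^ (-(a + 2) / 2) * (1 - t) := by
  rw [← Real.rpow_add_one (sub_pos.2 ht).ne', h]
  congr 1
  ring

theorem one_sub_rpow_of_eq_add_two {t : ℝ} (ht : t < 1) {a b : ℝ} (h : b = a + 2) :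
    (1 - t) ^ (-(b + 2) / 2) = (1 - t) ^ (-(a + 2) / 2) / (1 - t) := by
  rw [← Real.rpow_sub_one (sub_pos.2 ht).ne', h]
  congr 1
  ring

theorem genFun_recurrence_left (B : ℝ → ℝ → ℝ) (μ ν : ℝ) {t : ℝ} (ht : t < 1) (x : ℝ) :
    μ * (genFun B μ ν t x - t * genFun B μ ν t x) =
      2 * (genFun B (μ - 2) ν t x - (x / 2) ^ 2 * (t * (t * genFun B (μ + 2) ν t x))) := by
  have h := tildeI_recurrence (μ / 2) (t * x / (1 - t))
  have h1 : 1 - t ≠ 0 := (sub_pos.2 ht).ne'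
  unfold genFun
  rw [one_sub_rpow_of_eq_sub_two ht (show μ - 2 + ν = μ + ν - 2 by ring),
    one_sub_rpow_of_eq_add_two ht (show μ + 2 + ν = μ + ν + 2 by ring),
    show (μ - 2) / 2 = μ / 2 - 1 by ring, show (μ + 2) / 2 = μ / 2 + 1 by ring]
  generalize (1 - t) ^ (-(μ + ν + 2) / 2) = P
  generalize B (ν / 2) (x / (1 - t)) = Q
  have e : P / (1 - t) = P * (1 - t) * (1 - t)⁻¹ ^ 2 := by field_simp
  rw [e]
  linear_combination 2 * P * (1 - t) * Q * h

/-- A family of functions on `(0, ∞)` satisfying the derivative formula and the three-term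
recurrence of the normalized Bessel functions, with sign `ε`. -/
structure IsBesselFamily (ε : ℝ) (B : ℝ → ℝ → ℝ) : Prop where
  hasDerivAt : ∀ α z, 0 < z → HasDerivAt (B α) (ε * (z / 2 * B (α + 1) z)) z
  recurrence : ∀ α z, 0 < z →
    α * B α z = ε * (B (α - 1) z - (z / 2) ^ 2 * B (α + 1) z)

theorem isBesselFamily_tildeI : IsBesselFamily 1 tildeI where
  hasDerivAt α z _ := by simpa using hasDerivAt_tildeI α z
  recurrence α z _ := by simpa using tildeI_recurrence α z

theorem isBesselFamily_tildeK : IsBesselFamily (-1) tildeK where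
  hasDerivAt α z hz := by simpa using hasDerivAt_tildeK hz α
  recurrence α z hz := by
    rw [neg_one_mul]
    exact tildeK_recurrence hz α

namespace IsBesselFamily

variable {ε : ℝ} {B : ℝ → ℝ → ℝ}

theorem contDiffOn (hB : IsBesselFamily ε B) (α : ℝ) : ContDiffOn ℝ ∞ (B α) (Ioi 0) :=
  contDiffOn_of_hasDerivAt_shift isOpen_Ioi (g := fun z => ε * (z / 2)) (by fun_prop)
    (fun α z hz => by simpa only [mul_assoc] using hB.hasDerivAt α z hz) α

theorem contDiffOn_genFun (hB : IsBesselFamily ε B) (μ ν : ℝ) :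
    ContDiffOn ℝ ∞ (fun q : ℝ × ℝ => genFun B μ ν q.1 q.2) (Iio 1 ×ˢ Ioi 0) := by
  have h1 : ContDiffOn ℝ ∞ (fun q : ℝ × ℝ => 1 - q.1) (Iio 1 ×ˢ Ioi 0) := by fun_prop
  have h0 : ∀ q ∈ (Iio 1 ×ˢ Ioi 0 : Set (ℝ × ℝ)), 0 < 1 - q.1 := fun q hq => sub_pos.2 hq.1
  refine ((h1.rpow_const_of_ne fun q hq => (h0 q hq).ne').mul ?_).mul ?_
  · exact (contDiff_tildeI (μ / 2)).comp_contDiffOn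
      (ContDiffOn.div (by fun_prop) h1 fun q hq => (h0 q hq).ne')
  · exact (hB.contDiffOn (ν / 2)).comp
      (ContDiffOn.div (by fun_prop) h1 fun q hq => (h0 q hq).ne')
      fun q hq => div_pos hq.2 (h0 q hq)

theorem contDiffAt_genFun (hB : IsBesselFamily ε B) (μ ν : ℝ) {x : ℝ} (hx : 0 < x) :
    ContDiffAt ℝ ∞ (fun t => genFun B μ ν t x) 0 := by
  have hU : IsOpen (Iio 1 ×ˢ Ioi 0 : Set (ℝ × ℝ)) := isOpen_Iio.prod isOpen_Ioi
  have h := (hB.contDiffOn_genFun μ ν).contDiffAt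
    (hU.mem_nhds (mk_mem_prod (mem_Iio.2 one_pos) (mem_Ioi.2 hx)))
  exact h.comp (0 : ℝ) (contDiffAt_id.prodMk contDiffAt_const)

theorem contDiffOn_genFun_sub (hB : IsBesselFamily ε B) (μ ν : ℝ) :
    ContDiffOn ℝ ∞ (fun q : ℝ × ℝ => genFun B μ ν q.1 q.2 - q.1 * genFun B μ ν q.1 q.2)
      (Iio 1 ×ˢ Ioi 0) :=
  (hB.contDiffOn_genFun μ ν).sub (contDiffOn_fst.mul (hB.contDiffOn_genFun μ ν))

theorem taylorCoeffZ_genFun_sub (hB : IsBesselFamily ε B) (μ ν : ℝ) (j : ℤ) {x : ℝ} (hx : 0 < x) :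
    taylorCoeffZ (fun t => genFun B μ ν t x - t * genFun B μ ν t x) j =
      taylorCoeffZ (fun t => genFun B μ ν t x) j -
        taylorCoeffZ (fun t => genFun B μ ν t x) (j - 1) := by
  have h := hB.contDiffAt_genFun μ ν hx
  rw [taylorCoeffZ_sub h h.id_mul, taylorCoeffZ_id_mul h]

theorem taylorCoeffZ_sq_mul_genFun (hB : IsBesselFamily ε B) (μ ν : ℝ) (j : ℤ) {x : ℝ}
    (hx : 0 < x) :
    taylorCoeffZ (fun t => t * (t * genFun B μ ν t x)) j =
      taylorCoeffZ (fun t => genFun B μ ν t x) (j - 2) := by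
  have h := hB.contDiffAt_genFun μ ν hx
  rw [taylorCoeffZ_id_mul h.id_mul, taylorCoeffZ_id_mul h]
  congr 1
  ring

theorem genFun_recurrence_right (hB : IsBesselFamily ε B) (μ ν : ℝ) {t : ℝ} (ht : t < 1) {x : ℝ}
    (hx : 0 < x) :
    ν * (genFun B μ ν t x - t * genFun B μ ν t x) =
      2 * ε * (genFun B μ (ν - 2) t x - (x / 2) ^ 2 * genFun B μ (ν + 2) t x) := by
  have h := hB.recurrence (ν / 2) (x / (1 - t)) (div_pos hx (sub_pos.2 ht))
  have h1 : 1 - t ≠ 0 := (sub_pos.2 ht).ne'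
  unfold genFun
  rw [one_sub_rpow_of_eq_sub_two ht (show μ + (ν - 2) = μ + ν - 2 by ring),
    one_sub_rpow_of_eq_add_two ht (show μ + (ν + 2) = μ + ν + 2 by ring),
    show (ν - 2) / 2 = ν / 2 - 1 by ring, show (ν + 2) / 2 = ν / 2 + 1 by ring]
  generalize (1 - t) ^ (-(μ + ν + 2) / 2) = P
  generalize tildeI (μ / 2) (t * x / (1 - t)) = Q
  have e : P / (1 - t) = P * (1 - t) * (1 - t)⁻¹ ^ 2 := by field_simp
  rw [e]
  linear_combination 2 * P * (1 - t) * Q * h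

theorem hasDerivAt_genFun_sub (hB : IsBesselFamily ε B) (μ ν : ℝ) {t : ℝ} (ht : t < 1) {x : ℝ}
    (hx : 0 < x) :
    HasDerivAt (fun y => genFun B μ ν t y - t * genFun B μ ν t y)
      (x / 2 * (t * (t * genFun B (μ + 2) ν t x)) + ε * (x / 2) * genFun B μ (ν + 2) t x) x := by
  have h1 : 1 - t ≠ 0 := (sub_pos.2 ht).ne'
  have hI := (hasDerivAt_tildeI (μ / 2) (t * x / (1 - t))).comp x
    (((hasDerivAt_id x).const_mul t).div_const (1 - t))
  have hK := (hB.hasDerivAt (ν / 2) (x / (1 - t)) (div_pos hx (sub_pos.2 ht))).comp x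
    ((hasDerivAt_id x).div_const (1 - t))
  have hG : HasDerivAt (fun y => genFun B μ ν t y) _ x :=
    (hI.const_mul ((1 - t) ^ (-(μ + ν + 2) / 2))).mul hK
  refine (hG.sub (hG.const_mul t)).congr_deriv ?_
  unfold genFun
  rw [one_sub_rpow_of_eq_add_two ht (show μ + 2 + ν = μ + ν + 2 by ring),
    one_sub_rpow_of_eq_add_two ht (show μ + (ν + 2) = μ + ν + 2 by ring),
    show (ν + 2) / 2 = ν / 2 + 1 by ring, show (μ + 2) / 2 = μ / 2 + 1 by ring]
  simp only [Function.comp_apply, id]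
  generalize (1 - t) ^ (-(μ + ν + 2) / 2) = P
  field_simp

theorem taylorCoeffZ_recurrence_left (hB : IsBesselFamily ε B) (μ ν : ℝ) (j : ℤ) {x : ℝ}
    (hx : 0 < x) :
    μ * (taylorCoeffZ (fun t => genFun B μ ν t x) j -
        taylorCoeffZ (fun t => genFun B μ ν t x) (j - 1)) =
      2 * (taylorCoeffZ (fun t => genFun B (μ - 2) ν t x) j -
        (x / 2) ^ 2 * taylorCoeffZ (fun t => genFun B (μ + 2) ν t x) (j - 2)) := by
  have hm := hB.contDiffAt_genFun (μ - 2) ν hx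
  have hp := hB.contDiffAt_genFun (μ + 2) ν hx
  rw [← hB.taylorCoeffZ_genFun_sub μ ν j hx, ← hB.taylorCoeffZ_sq_mul_genFun _ _ j hx,
    ← taylorCoeffZ_const_mul, ← taylorCoeffZ_const_mul,
    ← taylorCoeffZ_sub hm (contDiffAt_const.mul hp.id_mul.id_mul),
    ← taylorCoeffZ_const_mul]
  refine taylorCoeffZ_congr ?_ j
  filter_upwards [Iio_mem_nhds one_pos] with t ht using genFun_recurrence_left B μ ν ht x

theorem taylorCoeffZ_recurrence_right (hB : IsBesselFamily ε B) (μ ν : ℝ) (j : ℤ) {x : ℝ}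
    (hx : 0 < x) :
    ν * (taylorCoeffZ (fun t => genFun B μ ν t x) j -
        taylorCoeffZ (fun t => genFun B μ ν t x) (j - 1)) =
      2 * ε * (taylorCoeffZ (fun t => genFun B μ (ν - 2) t x) j -
        (x / 2) ^ 2 * taylorCoeffZ (fun t => genFun B μ (ν + 2) t x) j) := by
  have hm := hB.contDiffAt_genFun μ (ν - 2) hx
  have hp := hB.contDiffAt_genFun μ (ν + 2) hx
  rw [← hB.taylorCoeffZ_genFun_sub μ ν j hx, ← taylorCoeffZ_const_mul, ← taylorCoeffZ_const_mul,
    ← taylorCoeffZ_sub hm (contDiffAt_const.mul hp), ← taylorCoeffZ_const_mul]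
  refine taylorCoeffZ_congr ?_ j
  filter_upwards [Iio_mem_nhds one_pos] with t ht using hB.genFun_recurrence_right μ ν ht hx

theorem hasDerivAt_taylorCoeffZ_genFun_sub (hB : IsBesselFamily ε B) (μ ν : ℝ) (j : ℤ) {x : ℝ}
    (hx : 0 < x) :
    HasDerivAt (fun y => taylorCoeffZ (fun t => genFun B μ ν t y) j -
        taylorCoeffZ (fun t => genFun B μ ν t y) (j - 1))
      (x / 2 * taylorCoeffZ (fun t => genFun B (μ + 2) ν t x) (j - 2) +
        ε * (x / 2) * taylorCoeffZ (fun t => genFun B μ (ν + 2) t x) j) x := by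
  have hU : IsOpen (Iio 1 ×ˢ Ioi 0 : Set (ℝ × ℝ)) := isOpen_Iio.prod isOpen_Ioi
  have hm := hB.contDiffAt_genFun (μ + 2) ν hx
  have hp := hB.contDiffAt_genFun μ (ν + 2) hx
  have hH := hB.contDiffOn_genFun_sub μ ν
  rw [← hB.taylorCoeffZ_sq_mul_genFun _ _ j hx, ← taylorCoeffZ_const_mul,
    ← taylorCoeffZ_const_mul, ← taylorCoeffZ_add
      (contDiffAt_const.mul hm.id_mul.id_mul) (contDiffAt_const.mul hp)]
  have key : HasDerivAt
      (fun y => taylorCoeffZ (fun t => genFun B μ ν t y - t * genFun B μ ν t y) j)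
      (taylorCoeffZ (fun t => fderiv ℝ
        (fun q : ℝ × ℝ => genFun B μ ν q.1 q.2 - q.1 * genFun B μ ν q.1 q.2) (t, x) (0, 1)) j)
      x := by
    unfold taylorCoeffZ
    split_ifs
    · exact (hasDerivAt_iteratedDeriv_fst hU hH j.toNat
        (mk_mem_prod (mem_Iio.2 one_pos) (mem_Ioi.2 hx))).div_const _
    · exact hasDerivAt_const x 0
  refine (key.congr_of_eventuallyEq ?_).congr_deriv (taylorCoeffZ_congr ?_ j)
  · filter_upwards [Ioi_mem_nhds hx] with y hy using
      (hB.taylorCoeffZ_genFun_sub μ ν j hy).symm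
  · filter_upwards [Iio_mem_nhds one_pos] with t ht
    exact (hasDerivAt_snd hU hH (mk_mem_prod ht (mem_Ioi.2 hx))).unique
      (hB.hasDerivAt_genFun_sub μ ν ht hx)

end IsBesselFamily

/-- The three recurrence relations in the parameters `μ, ν` for `Λ_{1,j}^{μ,ν}` (with
`ε(1) = +1`) and `Λ_{2,j}^{μ,ν}` (with `ε(2) = −1`), `j ∈ ℤ`, `x > 0`. -/
theorem statement18 (μ ν : ℝ) (j : ℤ) (x : ℝ) (hx : 0 < x) :
    (μ * (Lambda₁Z μ ν j x - Lambda₁Z μ ν (j - 1) x)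
      = 2 * (Lambda₁Z (μ - 2) ν j x - (x / 2) ^ 2 * Lambda₁Z (μ + 2) ν (j - 2) x)) ∧
    (μ * (Lambda₂Z μ ν j x - Lambda₂Z μ ν (j - 1) x)
      = 2 * (Lambda₂Z (μ - 2) ν j x - (x / 2) ^ 2 * Lambda₂Z (μ + 2) ν (j - 2) x)) ∧
    (ν * (Lambda₁Z μ ν j x - Lambda₁Z μ ν (j - 1) x)
      = 2 * (Lambda₁Z μ (ν - 2) j x - (x / 2) ^ 2 * Lambda₁Z μ (ν + 2) j x)) ∧
    (ν * (Lambda₂Z μ ν j x - Lambda₂Z μ ν (j - 1) x)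
      = 2 * (-1) * (Lambda₂Z μ (ν - 2) j x - (x / 2) ^ 2 * Lambda₂Z μ (ν + 2) j x)) ∧
    (deriv (fun y => Lambda₁Z μ ν j y - Lambda₁Z μ ν (j - 1) y) x
      = x / 2 * Lambda₁Z (μ + 2) ν (j - 2) x + x / 2 * Lambda₁Z μ (ν + 2) j x) ∧
    (deriv (fun y => Lambda₂Z μ ν j y - Lambda₂Z μ ν (j - 1) y) x
      = x / 2 * Lambda₂Z (μ + 2) ν (j - 2) x + (-1) * (x / 2) * Lambda₂Z μ (ν + 2) j x) := by
  refine ⟨isBesselFamily_tildeI.taylorCoeffZ_recurrence_left μ ν j hx,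
    isBesselFamily_tildeK.taylorCoeffZ_recurrence_left μ ν j hx, ?_,
    isBesselFamily_tildeK.taylorCoeffZ_recurrence_right μ ν j hx, ?_,
    (isBesselFamily_tildeK.hasDerivAt_taylorCoeffZ_genFun_sub μ ν j hx).deriv⟩
  · have h := isBesselFamily_tildeI.taylorCoeffZ_recurrence_right μ ν j hx
    rw [mul_one] at h
    exact h
  · have h := (isBesselFamily_tildeI.hasDerivAt_taylorCoeffZ_genFun_sub μ ν j hx).deriv
    rw [one_mul] at h
    exact h
end
end
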